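/- arXiv:math/0406249 — 2 statements merged into one kernel-verified Lean document; each statement's English description precedes it below -/
import Mathlib

section
/- For any finite abelian group G one has |G|^{−1} · |End(G)|^{1/4} ≤ |Sub(G)| ≤ |G|² · |End(G)|^{1/4}. -/
theorem aux_hom_zmod (m n : ℕ) [NeZero m] [NeZero n] :
    Nat.card (ZMod m →+ ZMod n) = Nat.gcd m n := by
  have e : (ZMod m →+ ZMod n) ≃ (nsmulAddMonoidHom m : ZMod n →+ ZMod n).ker :=
    (ZMod.lift m (A := ZMod n)).symm.trans
      { toFun := fun f => ⟨f.1 1, by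
          have := f.2
          rw [AddMonoidHom.mem_ker]
          simp only [nsmulAddMonoidHom_apply]
          rw [← map_nsmul]
          simpa using this⟩
        invFun := fun x => ⟨zmultiplesHom _ x.1, by
          have := x.2
          rw [AddMonoidHom.mem_ker] at this
          simpa using this⟩
        left_inv := fun f => by
          ext; simp
        right_inv := fun x => by
          ext; simp }
  rw [Nat.card_congr e]
  have := IsAddCyclic.card_nsmulAddMonoidHom_ker (G := ZMod n) m
  simpa [Nat.gcd_comm] using this

theorem aux_hom_pi {ι κ : Type*} [Fintype ι] [Fintype κ] [DecidableEq ι]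
    (A : ι → Type*) (B : κ → Type*) [∀ i, AddCommGroup (A i)] [∀ i, AddCommGroup (B i)] :
    Nat.card ((∀ i, A i) →+ (∀ j, B j)) = ∏ i, ∏ j, Nat.card (A i →+ B j) := by
  have e1 : ((∀ i, A i) →+ (∀ j, B j)) ≃ ((i : ι) → (j : κ) → (A i →+ B j)) :=
    (addMonoidHomLequivInt ℤ).toEquiv.trans <|
    (LinearMap.lsum ℤ A ℤ (M := ∀ j, B j)).symm.toEquiv.trans <|
    Equiv.piCongrRight fun i =>
     { toFun := fun f j => (Pi.evalAddMonoidHom B j).comp f.toAddMonoidHom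
       invFun := fun g => (AddMonoidHom.pi g).toIntLinearMap
       left_inv := fun f => rfl
       right_inv := fun f => rfl }
  rw [Nat.card_congr e1, Nat.card_pi]
  simp [Nat.card_pi]

theorem aux_cut {ι : Type*} [DecidableEq ι] (w : ι → ι → ℕ) (hs : ∀ i j, w i j = w j i) (T : Finset ι) :
    ∃ S ⊆ T, ∏ i ∈ T, ∏ j ∈ T, w i j ≤ (∏ i ∈ S, ∏ j ∈ T \ S, w i j) ^ 4 * ∏ i ∈ T, w i i := by
  induction T using Finset.induction_on with
  | empty => exact ⟨∅, by simp⟩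
  | insert k T hk ih =>
    obtain ⟨S, hS, h⟩ := ih
    have hkS : k ∉ S := fun h => hk (hS h)
    set a := ∏ i ∈ S, w i k
    set b := ∏ i ∈ T \ S, w i k
    set c := ∏ i ∈ S, ∏ j ∈ T \ S, w i j
    have hab : ∏ i ∈ T, w i k = a * b := by
      rw [mul_comm]; exact (Finset.prod_sdiff hS).symm
    have hL : ∏ i ∈ insert k T, ∏ j ∈ insert k T, w i j =
        (∏ i ∈ T, ∏ j ∈ T, w i j) * w k k * (a * b) ^ 2 := by
      rw [Finset.prod_insert hk, Finset.prod_insert hk]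
      simp_rw [Finset.prod_insert hk, Finset.prod_mul_distrib, hs k, hab]
      ring
    rw [hL, Finset.prod_insert hk]
    rcases le_total a b with hle | hle
    · refine ⟨insert k S, Finset.insert_subset_insert _ hS, ?_⟩
      have : insert k T \ insert k S = T \ S := by
        ext x; simp only [Finset.mem_sdiff, Finset.mem_insert]; grind
      rw [this, Finset.prod_insert hkS]
      simp_rw [hs k]
      change _ ≤ (b * c) ^ 4 * _
      calc _ ≤ (c ^ 4 * ∏ i ∈ T, w i i) * w k k * (b * b) ^ 2 := by gcongr
        _ = _ := by ring
    · refine ⟨S, hS.trans (Finset.subset_insert _ _), ?_⟩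
      have : insert k T \ S = insert k (T \ S) := by
        ext x; simp only [Finset.mem_sdiff, Finset.mem_insert]; grind
      rw [this]
      have hk' : k ∉ T \ S := by simp [hk]
      simp_rw [Finset.prod_insert hk', Finset.prod_mul_distrib]
      change _ ≤ (a * c) ^ 4 * _
      calc _ ≤ (c ^ 4 * ∏ i ∈ T, w i i) * w k k * (a * a) ^ 2 := by gcongr
        _ = _ := by ring

theorem aux_lower {ι : Type*} [Fintype ι] (n : ι → ℕ) [∀ i, NeZero (n i)] :
    ∏ i, ∏ j, Nat.gcd (n i) (n j) ≤
      Nat.card (AddSubgroup (∀ i, ZMod (n i))) ^ 4 * ∏ i, n i := by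
  classical
  obtain ⟨S, -, h⟩ := aux_cut (fun i j => Nat.gcd (n i) (n j)) (fun i j => Nat.gcd_comm _ _) Finset.univ
  simp only [Nat.gcd_self] at h
  refine h.trans ?_
  gcongr
  let A := ∀ i : {x // x ∈ S}, ZMod (n i)
  let B := ∀ i : {x // x ∉ S}, ZMod (n i)
  have hc : Nat.card (A →+ B) = ∏ i ∈ S, ∏ j ∈ Finset.univ \ S, Nat.gcd (n i) (n j) := by
    rw [aux_hom_pi]
    simp_rw [aux_hom_zmod]
    rw [← Finset.prod_coe_sort S]
    refine Finset.prod_congr rfl fun i _ => ?_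
    rw [Finset.prod_subtype (Finset.univ \ S) (p := fun x => x ∉ S) (by simp)]
  rw [← hc]
  let F : (∀ i, ZMod (n i)) →+ A := AddMonoidHom.pi fun i => Pi.evalAddMonoidHom _ i.1
  let G : (∀ i, ZMod (n i)) →+ B := AddMonoidHom.pi fun i => Pi.evalAddMonoidHom _ i.1
  refine Nat.card_le_card_of_injective
    (fun f : A →+ B => (f.comp F - G).ker) ?_
  intro f g hfg
  refine AddMonoidHom.ext fun x => ?_
  let y : ∀ i, ZMod (n i) := fun i => if h : i ∈ S then x ⟨i, h⟩ else f x ⟨i, h⟩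
  have hF : F y = x := by
    funext i; exact dif_pos i.2
  have hG : G y = f x := by
    funext i; exact dif_neg i.2
  have hy : y ∈ (f.comp F - G).ker := by
    rw [AddMonoidHom.mem_ker]; simp [hF, hG]
  have hy2 : y ∈ (g.comp F - G).ker := by
    have : (f.comp F - G).ker = (g.comp F - G).ker := hfg
    rwa [this] at hy
  rw [AddMonoidHom.mem_ker] at hy2
  simp only [AddMonoidHom.sub_apply, AddMonoidHom.comp_apply, hF, hG, sub_eq_zero] at hy2
  exact hy2.symm

theorem aux_dim (p : ℕ) [Fact p.Prime] (V : Type*) [AddCommGroup V] [Finite V] [Module (ZMod p) V]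
    (r a : ℕ) (hV : Nat.card V = p ^ r) :
    Nat.card {W : Submodule (ZMod p) V // Module.finrank (ZMod p) W = a} * p ^ ((a - 1) * a) ≤
      p ^ (r * a) := by
  classical
  have hp : p.Prime := Fact.out
  let X := {W : Submodule (ZMod p) V // Module.finrank (ZMod p) W = a}
  let Y := Σ W : X, {s : Fin a → W.1 // LinearIndependent (ZMod p) s}
  have : Fintype X := Fintype.ofFinite _
  have h1 : Nat.card Y ≤ Nat.card (Fin a → V) := by
    have key : ∀ y : Y, Submodule.span (ZMod p) (Set.range fun i => ((y.2.1 i : y.1.1) : V)) = y.1.1 := by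
      rintro ⟨W, s, hs⟩
      have h := hs.span_eq_top_of_card_eq_finrank' (by simp [W.2])
      have := congrArg (Submodule.map W.1.subtype) h
      rw [Submodule.map_span, Submodule.map_top, Submodule.range_subtype, ← Set.range_comp] at this
      exact this
    refine Nat.card_le_card_of_injective (fun (y : Y) (i : Fin a) => ((y.2.1 i : y.1.1) : V)) ?_
    intro y z hyz
    have h := key y
    have h' := key z
    have e : y.1.1 = z.1.1 := by
      rw [← h, ← h']; exact congrArg (fun f => Submodule.span (ZMod p) (Set.range f)) hyz
    obtain ⟨W, s, hs⟩ := y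
    obtain ⟨W', s', hs'⟩ := z
    obtain rfl : W = W' := Subtype.ext e
    congr 2
    funext i
    exact Subtype.ext (congrFun hyz i)
  have h2 : Nat.card (Fin a → V) = p ^ (r * a) := by
    rw [Nat.card_fun, hV]; simp [pow_mul]
  have h3 : Nat.card X * p ^ ((a - 1) * a) ≤ Nat.card Y := by
    rw [Nat.card_sigma, Nat.card_eq_fintype_card, ← smul_eq_mul]
    refine Finset.card_nsmul_le_sum _ _ _ fun W _ => ?_
    rw [card_linearIndependent (by simp [W.2]), pow_mul]
    rw [W.2, ZMod.card]
    refine le_trans ?_ (Finset.pow_card_le_prod _ _ (p ^ (a - 1)) fun i _ => ?_)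
    · simp
    · have hi : (i : ℕ) ≤ a - 1 := by omega
      have h5 : p ^ (i : ℕ) ≤ p ^ (a - 1) := Nat.pow_le_pow_right hp.pos hi
      have h6 : p ^ a = p ^ (a - 1) * p := by
        rw [← pow_succ]; congr 1; omega
      have h7 : p ^ (a - 1) * 2 ≤ p ^ (a - 1) * p := Nat.mul_le_mul_left _ hp.two_le
      omega
  exact h3.trans (h1.trans h2.le)

theorem aux_subspaces (p : ℕ) [Fact p.Prime] (V : Type*) [AddCommGroup V] [Finite V]
    [Module (ZMod p) V] (r : ℕ) (hr : 1 ≤ r) (hV : Nat.card V = p ^ r) :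
    Nat.card (Submodule (ZMod p) V) ^ 4 ≤ p ^ (r ^ 2 + 8 * r) := by
  classical
  have hp : p.Prime := Fact.out
  have : Fintype V := Fintype.ofFinite _
  have hfr : Module.finrank (ZMod p) V = r := by
    have := Module.card_eq_pow_finrank (K := ZMod p) (V := V)
    rw [← Nat.card_eq_fintype_card, hV, ZMod.card] at this
    exact (Nat.pow_right_injective hp.two_le this).symm
  have hdim : ∀ a ≤ r, Nat.card {W : Submodule (ZMod p) V // Module.finrank (ZMod p) W = a} ≤
      p ^ (r ^ 2 / 4) * p ^ a := by
    intro a ha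
    have h := aux_dim p V r a hV
    refine Nat.le_of_mul_le_mul_right (h.trans ?_) (pow_pos hp.pos ((a - 1) * a))
    rw [← pow_add, ← pow_add]
    refine Nat.pow_le_pow_right hp.pos ?_
    obtain ⟨b, rfl⟩ := Nat.exists_eq_add_of_le ha
    have h1 : a * b ≤ (a + b) ^ 2 / 4 := by
      rw [Nat.le_div_iff_mul_le (by norm_num)]
      nlinarith [sq_nonneg ((a : ℤ) - b), sq_nonneg ((a:ℤ)+b), show ((a:ℤ) * b * 4 ≤ (a+b)^2) by nlinarith [sq_nonneg ((a : ℤ) - b)]]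
    have h2 : (a - 1) * a + a = a * a := by
      cases a <;> simp; ring
    nlinarith
  have hN : Nat.card (Submodule (ZMod p) V) ≤ p ^ (r ^ 2 / 4) * p ^ (r + 1) := by
    have e := Equiv.sigmaFiberEquiv (fun W : Submodule (ZMod p) V =>
      (⟨Module.finrank (ZMod p) W, Nat.lt_succ_of_le (hfr ▸ Submodule.finrank_le W)⟩ : Fin (r + 1)))
    rw [← Nat.card_congr e, Nat.card_sigma]
    calc _ ≤ ∑ a : Fin (r + 1), p ^ (r ^ 2 / 4) * p ^ (a : ℕ) := by
          refine Finset.sum_le_sum fun a _ => ?_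
          refine le_trans (le_of_eq ?_) (hdim a (by omega))
          refine Nat.card_congr (Equiv.subtypeEquivRight fun W => ?_)
          simp [Fin.ext_iff]
      _ = p ^ (r ^ 2 / 4) * ∑ a ∈ Finset.range (r + 1), p ^ a := by
          rw [← Finset.mul_sum, Fin.sum_univ_eq_sum_range (fun a => p ^ a)]
      _ ≤ _ := by
          gcongr
          exact (Nat.geomSum_lt hp.two_le (fun k hk => by simpa using hk)).le
  calc _ ≤ (p ^ (r ^ 2 / 4) * p ^ (r + 1)) ^ 4 := by gcongr
    _ = p ^ ((r ^ 2 / 4 + (r + 1)) * 4) := by rw [← pow_add, ← pow_mul]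
    _ ≤ _ := Nat.pow_le_pow_right hp.pos (by omega)

theorem aux_step (p : ℕ) [Fact p.Prime] {G G' : Type*} [AddCommGroup G] [AddCommGroup G']
    [Finite G] [Finite G'] (f : G →+ G') (hf : Function.Surjective f)
    (g : G' →+ G) (hg : Function.Injective g) (hgf : ∀ x, g (f x) = p • x) (r : ℕ) (hr : 1 ≤ r)
    (hc : Nat.card G = p ^ r * Nat.card G') :
    Nat.card (AddSubgroup G) ^ 4 ≤ Nat.card (AddSubgroup G') ^ 4 * p ^ (r ^ 2 + 8 * r) := by
  classical
  have : Fintype (AddSubgroup G') := Fintype.ofFinite _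
  have hker : Nat.card f.ker = p ^ r := by
    have h1 := AddSubgroup.card_mul_index f.ker
    rw [AddSubgroup.index_ker, AddMonoidHom.range_eq_top.2 hf, AddSubgroup.card_top, hc] at h1
    exact Nat.eq_of_mul_eq_mul_right Nat.card_pos h1
  have hfib : ∀ K : AddSubgroup G', Nat.card {H : AddSubgroup G // H.map f = K} ^ 4 ≤
      p ^ (r ^ 2 + 8 * r) := by
    intro K
    let P := K.comap f
    let Q := (K.map g).addSubgroupOf P
    have hQP : K.map g ≤ P := by
      rintro _ ⟨y, hy, rfl⟩
      obtain ⟨x, rfl⟩ := hf y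
      rw [hgf]
      refine AddSubgroup.mem_comap.2 ?_
      rw [map_nsmul]
      exact K.nsmul_mem hy _
    let V := P ⧸ Q
    let _ : Module (ZMod p) V := QuotientAddGroup.zmodModule (n := p) (H := Q) (by
      intro x
      refine AddSubgroup.mem_addSubgroupOf.2 ?_
      exact ⟨f x, x.2, by simp [hgf]⟩)
    have hcQ : Nat.card Q = Nat.card K := by
      rw [Nat.card_congr (AddSubgroup.addSubgroupOfEquivOfLe hQP).toEquiv]
      exact (Nat.card_congr (K.equivMapOfInjective g hg).toEquiv).symm
    have hcP : Nat.card P = p ^ r * Nat.card K := by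
      let f' : P →+ K := f.addSubgroupComap K
      have hf' : Function.Surjective f' := AddMonoidHom.addSubgroupComap_surjective_of_surjective f K hf
      have h1 := AddSubgroup.card_mul_index f'.ker
      rw [AddSubgroup.index_ker, AddMonoidHom.range_eq_top.2 hf', AddSubgroup.card_top] at h1
      rw [← h1, ← hker]
      congr 1
      refine Nat.card_congr
        { toFun := fun x => ⟨x.1.1, by
            have := x.2
            rw [AddMonoidHom.mem_ker] at this ⊢
            exact congrArg Subtype.val this⟩
          invFun := fun x => ⟨⟨x.1, by
            have := x.2
            rw [AddMonoidHom.mem_ker] at this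
            refine AddSubgroup.mem_comap.2 ?_
            rw [this]; exact K.zero_mem⟩, by
            have := x.2
            rw [AddMonoidHom.mem_ker] at this ⊢
            exact Subtype.ext this⟩
          left_inv := fun x => rfl
          right_inv := fun x => rfl }
    have hV : Nat.card V = p ^ r := by
      have h1 := AddSubgroup.card_eq_card_quotient_mul_card_addSubgroup Q
      rw [hcP, hcQ] at h1
      exact (Nat.eq_of_mul_eq_mul_right Nat.card_pos h1).symm
    refine le_trans ?_ (aux_subspaces p V r hr hV)
    rw [← Nat.card_congr (AddSubgroup.toZModSubmodule (M := V) p).toEquiv]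
    refine Nat.pow_le_pow_left ?_ 4
    refine Nat.card_le_card_of_injective
      (fun H => (H.1.addSubgroupOf P).map (QuotientAddGroup.mk' Q)) ?_
    have hrec : ∀ H : {H : AddSubgroup G // H.map f = K},
        (((H.1.addSubgroupOf P).map (QuotientAddGroup.mk' Q)).comap (QuotientAddGroup.mk' Q)).map P.subtype = H.1 := by
      rintro ⟨H, hH⟩
      have hHP : H ≤ P := by
        rw [← AddSubgroup.map_le_iff_le_comap, hH]
      have hKH : K.map g ≤ H := by
        rw [← hH]
        rintro _ ⟨_, ⟨x, hx, rfl⟩, rfl⟩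
        rw [hgf]; exact H.nsmul_mem hx _
      rw [AddSubgroup.comap_map_eq, QuotientAddGroup.ker_mk', sup_eq_left.2]
      · rw [AddSubgroup.addSubgroupOf_map_subtype, inf_eq_left.2 hHP]
      · intro x hx
        exact hKH hx
    intro H H' h
    apply Subtype.ext
    rw [← hrec H, ← hrec H']
    exact congrArg (fun Z => (AddSubgroup.comap (QuotientAddGroup.mk' Q) Z).map P.subtype) h
  obtain ⟨K0, hK0⟩ := Finite.exists_max
    (fun K : AddSubgroup G' => Nat.card {H : AddSubgroup G // H.map f = K})
  have h1 : Nat.card (AddSubgroup G) ≤ Nat.card (AddSubgroup G') *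
      Nat.card {H : AddSubgroup G // H.map f = K0} := by
    rw [← Nat.card_congr (Equiv.sigmaFiberEquiv (fun H : AddSubgroup G => H.map f)),
      Nat.card_sigma, Nat.card_eq_fintype_card (α := AddSubgroup G'), ← smul_eq_mul]
    exact Finset.sum_le_card_nsmul _ _ _ fun K _ => hK0 K
  calc _ ≤ _ := Nat.pow_le_pow_left h1 4
    _ = _ := mul_pow _ _ _
    _ ≤ _ := Nat.mul_le_mul_left _ (hfib K0)

theorem aux_cyc (p : ℕ) [Fact p.Prime] (n m : ℕ)
    (hm : m = if p ∣ n then n / p else n) :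
    ∃ (f : ZMod n →+ ZMod m) (g : ZMod m →+ ZMod n),
      Function.Surjective f ∧ Function.Injective g ∧ ∀ x, g (f x) = p • x := by
  have hp : p.Prime := Fact.out
  split_ifs at hm with h
  · obtain ⟨k, rfl⟩ := h
    rw [Nat.mul_div_cancel_left k hp.pos] at hm
    subst hm
    refine ⟨(ZMod.castHom (Dvd.intro_left p rfl) (ZMod m)).toAddMonoidHom,
      ZMod.lift m ⟨zmultiplesHom _ (p : ZMod (p * m)), ?_⟩,
      ZMod.castHom_surjective (Dvd.intro_left p rfl), ?_, ?_⟩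
    · have : ((p * m : ℕ) : ZMod (p * m)) = 0 := ZMod.natCast_self _
      push_cast at this
      simp [mul_comm, this]
    · rw [ZMod.lift_injective]
      intro x hx
      have h1 : ((x * p : ℤ) : ZMod (p * m)) = 0 := by
        push_cast
        simpa using hx
      rw [ZMod.intCast_zmod_eq_zero_iff_dvd] at h1
      rw [ZMod.intCast_zmod_eq_zero_iff_dvd]
      push_cast at h1
      rw [mul_comm x] at h1
      exact Int.dvd_of_mul_dvd_mul_left (by exact_mod_cast hp.ne_zero) h1
    · intro x
      obtain ⟨x, rfl⟩ := ZMod.intCast_surjective x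
      have : (ZMod.castHom (Dvd.intro_left p rfl) (ZMod m)).toAddMonoidHom (x : ZMod (p * m)) = (x : ZMod m) := by
        simp
      rw [this, ZMod.lift_coe]
      simp [mul_comm]
  · subst hm
    refine ⟨AddMonoidHom.id _, nsmulAddMonoidHom p, Function.surjective_id, ?_, fun x => rfl⟩
    have hu : IsUnit (p : ZMod m) := (ZMod.isUnit_iff_coprime p m).2 ((Nat.Prime.coprime_iff_not_dvd hp).2 h)
    intro x y hxy
    simp only [nsmulAddMonoidHom_apply, nsmul_eq_mul] at hxy
    exact hu.mul_left_cancel hxy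

theorem aux_gcd (p : ℕ) (hp : p.Prime) (a b : ℕ) :
    Nat.gcd a b = (if p ∣ a then (if p ∣ b then p else 1) else 1) *
      Nat.gcd (if p ∣ a then a / p else a) (if p ∣ b then b / p else b) := by
  split_ifs with h1 h2 h2
  · obtain ⟨a, rfl⟩ := h1
    obtain ⟨b, rfl⟩ := h2
    simp [Nat.mul_div_cancel_left _ hp.pos, Nat.gcd_mul_left]
  · obtain ⟨a, rfl⟩ := h1
    rw [Nat.mul_div_cancel_left _ hp.pos, one_mul]
    exact Nat.Coprime.gcd_mul_left_cancel _ ((Nat.Prime.coprime_iff_not_dvd hp).2 h2)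
  · obtain ⟨b, rfl⟩ := h2
    rw [Nat.mul_div_cancel_left _ hp.pos, one_mul]
    exact Nat.Coprime.gcd_mul_left_cancel_right _ ((Nat.Prime.coprime_iff_not_dvd hp).2 h1)
  · simp

theorem aux_upper {ι : Type*} [Fintype ι] (N : ℕ) : ∀ (n : ι → ℕ), (∀ i, n i ≠ 0) → ∏ i, n i = N →
    Nat.card (AddSubgroup (∀ i, ZMod (n i))) ^ 4 ≤
      (∏ i, n i) ^ 8 * ∏ i, ∏ j, Nat.gcd (n i) (n j) := by
  classical
  induction N using Nat.strong_induction_on with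
  | _ N ih =>
    intro n hn hN
    have : ∀ i, NeZero (n i) := fun i => ⟨hn i⟩
    by_cases h1 : N = 1
    · rw [hN, h1]
      have h2 : ∀ i, n i = 1 := by
        intro i
        have := Finset.dvd_prod_of_mem n (Finset.mem_univ i)
        rw [hN, h1] at this
        exact Nat.dvd_one.1 this
      have : Subsingleton (∀ i, ZMod (n i)) := by
        have : ∀ i, Subsingleton (ZMod (n i)) := fun i => by rw [h2 i]; infer_instance
        infer_instance
      have : Nat.card (AddSubgroup (∀ i, ZMod (n i))) = 1 := by
        rw [Nat.card_eq_one_iff_unique]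
        exact ⟨inferInstance, inferInstance⟩
      rw [this]
      simp [h2]
    · obtain ⟨p, hp, hpN⟩ := Nat.exists_prime_and_dvd h1
      have : Fact p.Prime := ⟨hp⟩
      rw [← hN] at hpN
      obtain ⟨i0, -, hi0⟩ := (Prime.dvd_finsetProd_iff hp.prime _).1 hpN
      let m : ι → ℕ := fun i => if p ∣ n i then n i / p else n i
      have hnm : ∀ i, n i = (if p ∣ n i then p else 1) * m i := by
        intro i
        by_cases h : p ∣ n i
        · simp [m, h, Nat.mul_div_cancel' h]
        · simp [m, h]
      have hm : ∀ i, m i ≠ 0 := fun i h => hn i (by rw [hnm i, h, mul_zero])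
      have : ∀ i, NeZero (m i) := fun i => ⟨hm i⟩
      let r := (Finset.univ.filter fun i => p ∣ n i).card
      have hr : 1 ≤ r := Finset.card_pos.2 ⟨i0, by simp [hi0]⟩
      have hprod : ∏ i, n i = p ^ r * ∏ i, m i := by
        rw [Finset.prod_congr rfl fun i _ => hnm i, Finset.prod_mul_distrib, Finset.prod_ite]
        simp [r]
      have hgcd : ∏ i, ∏ j, Nat.gcd (n i) (n j) = p ^ (r ^ 2) * ∏ i, ∏ j, Nat.gcd (m i) (m j) := by
        rw [Finset.prod_congr rfl fun i _ => Finset.prod_congr rfl fun j _ => aux_gcd p hp (n i) (n j)]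
        simp_rw [Finset.prod_mul_distrib]
        congr 1
        have : ∀ i, ∏ j, (if p ∣ n i then (if p ∣ n j then p else 1) else 1) =
            if p ∣ n i then p ^ r else 1 := by
          intro i
          split_ifs
          · rw [Finset.prod_ite]; simp [r]
          · simp
        simp_rw [this]
        rw [Finset.prod_ite]
        simp [r, sq, pow_mul]
      choose f g hf hg hfg using fun i => aux_cyc p (n i) (m i) rfl
      have hmpos : 0 < ∏ i, m i := Finset.prod_pos fun i _ => Nat.pos_of_ne_zero (hm i)
      have hlt : ∏ i, m i < N := by
        rw [← hN, hprod]
        have : 1 < p ^ r := Nat.one_lt_pow (by omega) hp.one_lt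
        nlinarith
      have hstep := aux_step p (G := ∀ i, ZMod (n i)) (G' := ∀ i, ZMod (m i))
        (AddMonoidHom.pi fun i => (f i).comp (Pi.evalAddMonoidHom _ i))
        (fun y => ⟨fun i => (hf i (y i)).choose, funext fun i => (hf i (y i)).choose_spec⟩)
        (AddMonoidHom.pi fun i => (g i).comp (Pi.evalAddMonoidHom _ i))
        (fun x y hxy => funext fun i => hg i (congrFun hxy i))
        (fun x => funext fun i => hfg i (x i)) r hr (by
          simp [Nat.card_pi, hprod])
      refine hstep.trans ?_
      calc _ ≤ ((∏ i, m i) ^ 8 * ∏ i, ∏ j, Nat.gcd (m i) (m j)) * p ^ (r ^ 2 + 8 * r) := by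
            gcongr
            exact ih _ hlt m hm rfl
        _ = _ := by
          rw [hprod, hgcd, pow_add, mul_pow, ← pow_mul, mul_comm r 8]
          ring

theorem card_subgroups_vs_card_endomorphisms (G : Type*) [CommGroup G] [Finite G] :
    (Nat.card G : ℝ)⁻¹ * (Nat.card (Monoid.End G) : ℝ) ^ ((1 : ℝ) / 4) ≤
      (Nat.card (Subgroup G) : ℝ) ∧
    (Nat.card (Subgroup G) : ℝ) ≤
      (Nat.card G : ℝ) ^ 2 * (Nat.card (Monoid.End G) : ℝ) ^ ((1 : ℝ) / 4) := by
  classical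
  obtain ⟨ι, _, n, hn, ⟨e⟩⟩ := AddCommGroup.equiv_directSum_zmod_of_finite' (Additive G)
  have hn0 : ∀ i, n i ≠ 0 := fun i => by have := hn i; omega
  have : ∀ i, NeZero (n i) := fun i => ⟨hn0 i⟩
  let e' : Additive G ≃+ (∀ i, ZMod (n i)) := e.trans (DirectSum.addEquivProd _)
  have hG : Nat.card G = ∏ i, n i := by
    rw [Nat.card_congr (Additive.ofMul.trans e'.toEquiv)]
    simp [Nat.card_pi]
  have hE : Nat.card (Monoid.End G) = ∏ i, ∏ j, Nat.gcd (n i) (n j) := by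
    have e1 : Monoid.End G ≃ (Additive G →+ Additive G) := MonoidHom.toAdditive
    rw [Nat.card_congr (e1.trans (
      { toFun := fun φ => (e'.toAddMonoidHom.comp φ).comp e'.symm.toAddMonoidHom
        invFun := fun φ => (e'.symm.toAddMonoidHom.comp φ).comp e'.toAddMonoidHom
        left_inv := fun φ => by ext; simp
        right_inv := fun φ => AddMonoidHom.ext fun x => by simp } :
      (Additive G →+ Additive G) ≃ ((∀ i, ZMod (n i)) →+ (∀ i, ZMod (n i))))), aux_hom_pi]
    simp_rw [aux_hom_zmod]
  have hS : Nat.card (Subgroup G) = Nat.card (AddSubgroup (∀ i, ZMod (n i))) :=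
    Nat.card_congr (Subgroup.toAddSubgroup.toEquiv.trans e'.mapAddSubgroup.toEquiv)
  have hlow := aux_lower n
  have hup := aux_upper _ n hn0 rfl
  rw [← hS, ← hE, ← hG] at hlow hup
  have hGpos : 1 ≤ Nat.card G := Nat.card_pos
  generalize Nat.card G = a at *
  generalize Nat.card (Monoid.End G) = b at *
  generalize Nat.card (Subgroup G) = c at *
  have ha : (1 : ℝ) ≤ a := by exact_mod_cast hGpos
  have hlow' : (b : ℝ) ≤ c ^ 4 * a := by exact_mod_cast hlow
  have hup' : (c : ℝ) ^ 4 ≤ a ^ 8 * b := by exact_mod_cast hup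
  set t : ℝ := (b : ℝ) ^ ((1 : ℝ) / 4) with ht
  have ht0 : 0 ≤ t := Real.rpow_nonneg (Nat.cast_nonneg b) _
  have ht4 : t ^ 4 = b := by
    rw [ht, ← Real.rpow_natCast, ← Real.rpow_mul (Nat.cast_nonneg b)]
    norm_num
  constructor
  · rw [inv_mul_le_iff₀ (by linarith)]
    refine le_of_pow_le_pow_left₀ (n := 4) (by norm_num) (by positivity) ?_
    rw [ht4, mul_pow]
    have h4 : (a : ℝ) ≤ a ^ 4 := le_self_pow₀ ha (by norm_num)
    have : (c : ℝ) ^ 4 * a ≤ c ^ 4 * a ^ 4 := by gcongr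
    linarith
  · refine le_of_pow_le_pow_left₀ (n := 4) (by norm_num) (by positivity) ?_
    rw [mul_pow, ht4, ← pow_mul]
    exact hup'
end

section
/- Let 1 → K → U → L → 1 be an exact sequence of finite groups where K is solvable of derived length ℓ and every subgroup of K can be generated by r elements. Then the number of subgroups H of U with π(H) = L is at most |U|^{3r² + ℓr}. -/
theorem aux_fiber {α β : Type*} [Finite α] [Finite β] (f : α → β) (k : ℕ)
    (h : ∀ b, Nat.card {a // f a = b} ≤ k) : Nat.card α ≤ Nat.card β * k := by
  classical
  have _inst := Fintype.ofFinite β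
  rw [← Nat.card_congr (Equiv.sigmaFiberEquiv f), Nat.card_sigma, Nat.card_eq_fintype_card]
  calc _ ≤ ∑ _a : β, k := Finset.sum_le_sum fun b _ => h b
    _ = _ := by simp

theorem aux_idx_gen {p : ℕ} [hp : Fact p.Prime] {G : Type*} [Group G] [Finite G] (hG : IsPGroup p G)
    (k : ℕ) : ∀ N : Subgroup G, N.index ≤ p ^ k →
    ∃ S : Finset G, S.card ≤ k ∧ Subgroup.closure (S : Set G) ⊔ N = ⊤ := by
  classical
  induction k with
  | zero =>
    intro N hN
    refine ⟨∅, by simp, ?_⟩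
    have h0 : N.index ≠ 0 := Subgroup.FiniteIndex.index_ne_zero
    have : N.index = 1 := by simp at hN; omega
    rw [Subgroup.index_eq_one] at this
    simp [this]
  | succ k ih =>
    intro N hN
    by_cases hT : N = ⊤
    · exact ⟨∅, by simp, by simp [hT]⟩
    obtain ⟨g, hg⟩ : ∃ g, g ∉ N := by
      by_contra! hc
      exact hT (by ext x; simp [hc x])
    set N' := N ⊔ Subgroup.zpowers g with hN'
    have hle : N ≤ N' := le_sup_left
    have hgN' : g ∈ N' := (le_sup_right : Subgroup.zpowers g ≤ N') (Subgroup.mem_zpowers g)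
    have hmul := Subgroup.relIndex_mul_index hle
    have hri : p ≤ N.relIndex N' := by
      obtain ⟨n, hn⟩ := (hG.to_subgroup N').index (N.subgroupOf N')
      have hn' : N.relIndex N' = p ^ n := hn
      rw [hn']
      rcases Nat.eq_zero_or_pos n with h | h
      · subst h
        exfalso
        rw [pow_zero, Subgroup.relIndex_eq_one] at hn'
        exact hg (hn' hgN')
      · exact Nat.le_self_pow h.ne' p
    have hN'i : N'.index ≤ p ^ k := by
      have h1 : p * N'.index ≤ p * p ^ k := by
        calc p * N'.index ≤ N.relIndex N' * N'.index := Nat.mul_le_mul_right _ hri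
          _ = N.index := hmul
          _ ≤ p ^ (k+1) := hN
          _ = p * p ^ k := by ring
      exact Nat.le_of_mul_le_mul_left h1 hp.out.pos
    obtain ⟨S, hS, hSc⟩ := ih N' hN'i
    refine ⟨insert g S, (Finset.card_insert_le _ _).trans (by omega), ?_⟩
    rw [eq_top_iff, ← hSc, hN']
    refine sup_le ?_ (sup_le le_sup_right ?_)
    · refine le_trans (Subgroup.closure_mono ?_) le_sup_left
      simp
    · refine le_trans ?_ le_sup_left
      rw [Subgroup.zpowers_le]
      exact Subgroup.subset_closure (by simp)

theorem aux_coatom {p : ℕ} [hp : Fact p.Prime] {G : Type*} [Group G] [Finite G] (hG : IsPGroup p G)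
    (M : Subgroup G) (hM : IsCoatom M) (g : G) : g ^ p ∈ M := by
  have _inst := hG.isNilpotent
  have : M.Normal := Subgroup.NormalizerCondition.normal_of_coatom M
    Group.normalizerCondition_of_isNilpotent hM
  by_contra hgp
  have hlt : M < M ⊔ Subgroup.zpowers (g ^ p) := by
    refine lt_of_le_of_ne le_sup_left fun h => hgp ?_
    rw [h]
    exact (le_sup_right : Subgroup.zpowers (g ^ p) ≤ _) (Subgroup.mem_zpowers _)
  have htop := hM.2 _ hlt
  have hg : g ∈ M ⊔ Subgroup.zpowers (g ^ p) := by rw [htop]; trivial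
  obtain ⟨m, hm, z, hz, hmz⟩ := Subgroup.mem_sup_of_normal_left.1 hg
  obtain ⟨k, rfl⟩ := hz
  have hq : g ^ ((p : ℤ) * k - 1) ∈ M := by
    have : g ^ ((p : ℤ) * k - 1) = (g ^ p) ^ k * g⁻¹ := by
      rw [zpow_sub, zpow_mul, zpow_natCast, zpow_one]
    rw [this, ← M.inv_mem_iff]
    have : ((g ^ p) ^ k * g⁻¹)⁻¹ = m := by
      rw [mul_inv_rev, inv_inv]
      rw [mul_inv_eq_iff_eq_mul]; exact hmz.symm
    rw [this]; exact hm
  obtain ⟨n, hn⟩ := hG g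
  have hco : IsCoprime ((p : ℤ) * k - 1) ((p : ℤ) ^ n) := by
    apply IsCoprime.pow_right
    exact ⟨-1, k, by ring⟩
  obtain ⟨a, b, hab⟩ := hco
  apply hgp
  apply M.pow_mem
  have : g = (g ^ ((p : ℤ) * k - 1)) ^ a * (g ^ (p ^ n)) ^ b := by
    rw [← zpow_mul, ← zpow_natCast, ← zpow_mul, ← zpow_add]
    push_cast
    rw [mul_comm _ a, mul_comm _ b, hab, zpow_one]
  rw [this, hn]
  simpa using M.zpow_mem hq a

theorem aux_frattini {p : ℕ} [hp : Fact p.Prime] {G : Type*} [Group G] [Finite G] (hG : IsPGroup p G)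
    (g : G) : g ^ p ∈ frattini G := by
  unfold frattini Order.radical
  simp only [Subgroup.mem_iInf]
  intro M hM
  exact aux_coatom hG M hM g

theorem aux_pow_fiber {E : Type*} [Ring E] (p n : ℕ) (hp0 : ((p : E)) ^ n = 0) (g h : E)
    (hg : ((p : E)) ^ 2 ∣ g - 1) (hh : ((p : E)) ^ 2 ∣ h - 1) (heq : g ^ p = h ^ p) :
    (p : E) * (g - h) = 0 := by
  have key : ∀ k : ℕ, (p : E) ^ k ∣ (p : E) * (g - h) := by
    intro k
    induction k with
    | zero => simp
    | succ k ih =>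
      obtain ⟨w, hw⟩ := ih
      have cp : ∀ x : E, x * (p : E) = p * x := fun x => (Nat.cast_commute p x).eq.symm
      have cpk : ∀ x : E, x * (p : E) ^ k = p ^ k * x := fun x =>
        ((Nat.cast_commute p x).pow_left k).eq.symm
      have main : ∀ m : ℕ, (p : E) ^ (k+1) ∣ g ^ m - h ^ m - m * (g - h) := by
        intro m
        induction m with
        | zero => simp
        | succ m ihm =>
          have e : g ^ (m+1) - h ^ (m+1) - ((m+1 : ℕ) : E) * (g - h) =
              (g ^ m - 1) * (g - h) + (g ^ m - h ^ m - m * (g - h)) * h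
                + m * ((g - h) * (h - 1)) := by
            push_cast
            rw [pow_succ, pow_succ]
            noncomm_ring
          rw [e]
          refine dvd_add (dvd_add ?_ ?_) ?_
          · obtain ⟨u, hu⟩ := hg.trans (sub_one_dvd_pow_sub_one g m)
            refine ⟨u * w, ?_⟩
            calc (g ^ m - 1) * (g - h) = p * (u * p * (g - h)) := by
                  rw [hu, cp, pow_two]; simp only [mul_assoc]
              _ = p * (u * (p ^ k * w)) := by rw [mul_assoc u, hw]
              _ = _ := by rw [← mul_assoc u, cpk, pow_succ']; simp only [mul_assoc]
          · obtain ⟨c, hc⟩ := ihm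
            exact ⟨c * h, by rw [hc, mul_assoc]⟩
          · obtain ⟨v, hv⟩ := hh
            refine ⟨m * (w * v), ?_⟩
            have : (g - h) * (h - 1) = p ^ (k+1) * (w * v) := by
              calc (g - h) * (h - 1) = p * ((p * (g - h)) * v) := by
                    rw [hv, pow_two, ← mul_assoc, ← mul_assoc, cp, mul_assoc (p : E), cp]
                _ = _ := by rw [hw, pow_succ']; simp only [mul_assoc]
            rw [this, ← mul_assoc, ← mul_assoc, ((Nat.cast_commute m _).eq)]
            simp only [mul_assoc]
      have := main p
      rw [heq, sub_self, zero_sub, dvd_neg] at this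
      exact this
  have := key n
  rwa [hp0, zero_dvd_iff] at this

/-- size of the `n`-torsion equals the index of `n E` -/
theorem aux_torsion {E : Type*} [AddCommGroup E] [Finite E] (n : ℕ) :
    (nsmulAddMonoidHom (α := E) n).range.index = Nat.card {x : E // n • x = 0} := by
  have h1 := AddSubgroup.card_mul_index (nsmulAddMonoidHom (α := E) n).range
  have h2 := AddSubgroup.card_mul_index (nsmulAddMonoidHom (α := E) n).ker
  rw [AddSubgroup.index_ker] at h2
  have h3 : Nat.card {x : E // n • x = 0} = Nat.card (nsmulAddMonoidHom (α := E) n).ker := rfl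
  rw [h3]
  have h4 : 0 < Nat.card (nsmulAddMonoidHom (α := E) n).range := Nat.card_pos
  apply Nat.eq_of_mul_eq_mul_left h4
  rw [h1, ← h2, mul_comm]

theorem aux_gen {p : ℕ} [hp : Fact p.Prime] {E : Type*} [Ring E] [Finite E] [Nontrivial E]
    (n s : ℕ) (hp0 : ((p : E)) ^ n = 0)
    (h1 : Nat.card {x : E // p • x = 0} ≤ p ^ s)
    (h2 : Nat.card {x : E // (p ^ 2) • x = 0} ≤ p ^ (2 * s))
    {Q : Type*} [Group Q] [Finite Q] (hQ : IsPGroup p Q) (φ : Q →* E)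
    (hφ : Function.Injective φ) :
    ∃ S : Finset Q, S.card ≤ 3 * s - 1 ∧ Subgroup.closure (S : Set Q) = ⊤ := by
  classical
  have cp : ∀ x : E, x * (p : E) ^ 2 = p ^ 2 * x := fun x =>
        ((Nat.cast_commute p x).pow_left 2).eq.symm
  have hl : ∀ x y : E, (p : E) ^ 2 ∣ y → (p : E) ^ 2 ∣ x * y := by
    rintro x y ⟨c, rfl⟩
    exact ⟨x * c, by rw [← mul_assoc, cp, mul_assoc]⟩
  let N : Subgroup Q :=
    { carrier := {g | (p : E) ^ 2 ∣ φ g - 1}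
      one_mem' := by simp
      mul_mem' := by
        intro a b ha hb
        have : φ (a * b) - 1 = (φ a - 1) * φ b + (φ b - 1) := by
          rw [map_mul]; noncomm_ring
        show _ ∣ φ (a * b) - 1
        rw [this]
        exact dvd_add (Dvd.dvd.mul_right ha _) hb
      inv_mem' := by
        intro a ha
        have : φ (a⁻¹) - 1 = - ((φ a - 1) * φ a⁻¹) := by
          rw [sub_mul, ← map_mul]; simp
        show _ ∣ φ (a⁻¹) - 1
        rw [this, dvd_neg]
        exact Dvd.dvd.mul_right ha _ }
  have memN : ∀ g, g ∈ N ↔ (p : E) ^ 2 ∣ φ g - 1 := fun g => Iff.rfl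
  set R := (nsmulAddMonoidHom (α := E) (p ^ 2)).range with hR
  have memR : ∀ x : E, x ∈ R ↔ (p : E) ^ 2 ∣ x := by
    intro x
    constructor
    · rintro ⟨y, rfl⟩
      exact ⟨y, by simp [nsmul_eq_mul]⟩
    · rintro ⟨y, rfl⟩
      exact ⟨y, by simp [nsmul_eq_mul]⟩
  have hidx : N.index < p ^ (2 * s) := by
    refine lt_of_lt_of_le ?_ (h2.trans' (aux_torsion (E := E) (p ^ 2)).le)
    let F : Q ⧸ N → E ⧸ R := fun q => QuotientAddGroup.mk (φ q.out)
    have hF : Function.Injective F := by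
      intro a b hab
      have h := QuotientAddGroup.eq.1 hab
      rw [memR] at h
      rw [← Quotient.out_eq a, ← Quotient.out_eq b]
      refine QuotientGroup.eq.2 ?_
      rw [memN]
      have : φ (a.out⁻¹ * b.out) - 1 = φ (a.out⁻¹) * (- φ a.out + φ b.out) := by
        rw [mul_add, mul_neg, ← map_mul, ← map_mul]; simp; abel
      rw [this]
      exact hl _ _ h
    have h0 : (0 : E ⧸ R) ∉ Set.range F := by
      rintro ⟨q, hq⟩
      have h := (QuotientAddGroup.eq_zero_iff _).1 hq
      rw [memR] at h
      have h' : (p : E) ^ 2 ∣ 1 := by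
        have := hl (φ (q.out⁻¹)) _ h
        rwa [← map_mul, inv_mul_cancel, map_one] at this
      obtain ⟨c, hc⟩ := h'
      have : (1 : E) = ((p : E) ^ 2) ^ n * c ^ n := by
        rw [← Commute.mul_pow ((Nat.cast_commute p c).pow_left 2), ← hc, one_pow]
      rw [← pow_mul, mul_comm, pow_mul, hp0] at this
      simp at this
    have _i1 := Fintype.ofFinite (Q ⧸ N)
    have _i2 := Fintype.ofFinite (E ⧸ R)
    have h3 := Fintype.card_lt_of_injective_of_notMem F hF (b := 0) h0
    rw [← Nat.card_eq_fintype_card, ← Nat.card_eq_fintype_card] at h3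
    exact h3
  have hs : 1 ≤ 2 * s := by
    by_contra hc
    have : 2 * s = 0 := by omega
    rw [this, pow_zero] at hidx
    have h0 : N.index ≠ 0 := Subgroup.FiniteIndex.index_ne_zero
    omega
  have hidx' : N.index ≤ p ^ (2 * s - 1) := by
    obtain ⟨j, hj⟩ := hQ.index N
    rw [hj] at hidx ⊢
    have := (Nat.pow_lt_pow_iff_right hp.out.one_lt).1 hidx
    exact Nat.pow_le_pow_right hp.out.pos (by omega)
  obtain ⟨S1, hS1, hS1c⟩ := aux_idx_gen hQ _ N hidx'
  have hNp : IsPGroup p N := hQ.to_subgroup N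
  have hfi : (frattini N).index ≤ p ^ s := by
    have hle : Nat.card N ≤ Nat.card (frattini N) * p ^ s := by
      refine aux_fiber (fun g : N => (⟨g ^ p, aux_frattini hNp g⟩ : frattini N)) _ ?_
      intro b
      by_cases hb : IsEmpty {a : N // (⟨a ^ p, aux_frattini hNp a⟩ : frattini N) = b}
      · simp
      rw [not_isEmpty_iff] at hb
      obtain ⟨⟨g0, hg0⟩⟩ := hb
      refine le_trans ?_ h1
      refine Nat.card_le_card_of_injective (fun a => ⟨φ a.1 - φ g0, ?_⟩) ?_
      · rw [nsmul_eq_mul]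
        refine aux_pow_fiber p n hp0 _ _ a.1.2 g0.2 ?_
        have := a.2.trans hg0.symm
        have h3 : (a.1 : N) ^ p = g0 ^ p := congrArg (fun x : frattini N => (x : N)) this
        have h4 : ((a.1 : N) : Q) ^ p = (g0 : Q) ^ p := by
          exact_mod_cast congrArg (fun x : N => (x : Q)) h3
        rw [← map_pow, h4, map_pow]
      · intro a b hab
        have h5 := Subtype.mk.inj hab
        have h6 := hφ (sub_left_injective h5)
        exact Subtype.ext (Subtype.ext h6)
    rw [← Subgroup.card_mul_index (frattini N)] at hle
    exact Nat.le_of_mul_le_mul_left hle Nat.card_pos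
  obtain ⟨S2, hS2, hS2c⟩ := aux_idx_gen hNp _ _ hfi
  have hS2t := frattini_nongenerating hS2c
  refine ⟨S1 ∪ S2.image N.subtype, ?_, ?_⟩
  · refine (Finset.card_union_le _ _).trans ?_
    have := Finset.card_image_le (s := S2) (f := N.subtype)
    omega
  · rw [Finset.coe_union, Subgroup.closure_union, Finset.coe_image, ← MonoidHom.map_closure, hS2t,
      ← MonoidHom.range_eq_map, Subgroup.range_subtype, hS1c]

def AuxGen (r : ℕ) (B : Type*) [AddCommGroup B] : Prop :=
  ∃ S : Finset B, S.card ≤ r ∧ AddSubgroup.closure (S : Set B) = ⊤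

theorem AuxGen.surj {r : ℕ} {B B' : Type*} [AddCommGroup B] [AddCommGroup B'] (h : AuxGen r B)
    (f : B →+ B') (hf : Function.Surjective f) : AuxGen r B' := by
  classical
  obtain ⟨S, hS, hc⟩ := h
  refine ⟨S.image f, Finset.card_image_le.trans hS, ?_⟩
  rw [Finset.coe_image, ← AddMonoidHom.map_closure, hc, ← AddMonoidHom.range_eq_map,
    AddMonoidHom.range_eq_top.2 hf]

theorem AuxGen.tors {r : ℕ} {B : Type*} [AddCommGroup B] [Finite B] (h : AuxGen r B) (n : ℕ)
    (hn : 0 < n) : Nat.card {x : B // n • x = 0} ≤ n ^ r := by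
  classical
  rw [← aux_torsion]
  set R := (nsmulAddMonoidHom (α := B) n).range with hR
  obtain ⟨S, hS, hc⟩ := h
  let F : (S → Fin n) → B ⧸ R := fun c => QuotientAddGroup.mk (∑ i : S, (c i : ℕ) • (i : B))
  have hF : Function.Surjective F := by
    intro y
    obtain ⟨x, rfl⟩ := QuotientAddGroup.mk_surjective y
    have hx : x ∈ AddSubgroup.closure (S : Set B) := by rw [hc]; trivial
    have hx' : ∃ c : S → ℤ, x = ∑ i : S, c i • (i : B) := by
      induction hx using AddSubgroup.closure_induction with
      | mem x hx =>
        refine ⟨Pi.single ⟨x, hx⟩ 1, ?_⟩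
        rw [Finset.sum_eq_single ⟨x, hx⟩]
        · simp
        · intro b _ hb; simp [Pi.single_eq_of_ne hb]
        · simp
      | zero => exact ⟨0, by simp⟩
      | add x y _ _ hx hy =>
        obtain ⟨c, rfl⟩ := hx
        obtain ⟨d, rfl⟩ := hy
        exact ⟨c + d, by simp [add_smul, Finset.sum_add_distrib]⟩
      | neg x _ hx =>
        obtain ⟨c, rfl⟩ := hx
        exact ⟨-c, by simp⟩
    obtain ⟨c, rfl⟩ := hx'
    have hn' : (0 : ℤ) < n := by exact_mod_cast hn
    refine ⟨fun i => ⟨(c i % n).toNat, ?_⟩, ?_⟩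
    · have := Int.emod_lt_of_pos (c i) hn'
      have := Int.emod_nonneg (c i) hn'.ne'
      omega
    · refine QuotientAddGroup.eq.2 ?_
      rw [neg_add_eq_sub, ← Finset.sum_sub_distrib]
      refine R.sum_mem fun i _ => ?_
      refine ⟨(c i / n) • (i : B), ?_⟩
      have h0 := Int.emod_nonneg (c i) hn'.ne'
      simp only [nsmulAddMonoidHom_apply]
      rw [← natCast_zsmul, ← natCast_zsmul, Int.toNat_of_nonneg h0, smul_smul, ← sub_smul]
      congr 1
      have := Int.emod_add_mul_ediv (c i) n
      linarith
  have h1 := Nat.card_le_card_of_surjective F hF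
  have h2 : Nat.card (S → Fin n) = n ^ S.card := by simp
  rw [h2] at h1
  exact h1.trans (Nat.pow_le_pow_right hn hS)

theorem AuxGen.endTors {r : ℕ} {B : Type*} [AddCommGroup B] [Finite B] (h : AuxGen r B) (n : ℕ)
    (hn : 0 < n) : Nat.card {x : AddMonoid.End B // n • x = 0} ≤ n ^ (r * r) := by
  classical
  have ht := h.tors n hn
  obtain ⟨S, hS, hc⟩ := h
  let F : {x : AddMonoid.End B // n • x = 0} → (S → {x : B // n • x = 0}) := fun f i =>
    ⟨f.1 i, DFunLike.congr_fun f.2 (i : B)⟩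
  have hF : Function.Injective F := by
    intro f g hfg
    apply Subtype.ext
    refine AddMonoidHom.eq_of_eqOn_dense hc ?_
    intro x hx
    exact congrArg Subtype.val (congrFun hfg ⟨x, hx⟩)
  refine (Nat.card_le_card_of_injective F hF).trans ?_
  rw [Nat.card_fun, pow_mul]
  have : Nat.card S ≤ r := by simpa using hS
  exact (Nat.pow_le_pow_left ht _).trans (Nat.pow_le_pow_right (by positivity) this)

universe u

/-- Crossed homomorphisms. -/
def AuxDer {G B : Type*} [Group G] [AddCommGroup B] (φ : G →* AddMonoid.End B) : Type _ :=
  {d : G → B // ∀ g h, d (g * h) = d g + φ g (d h)}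

instance {G B : Type*} [Group G] [AddCommGroup B] [Finite G] [Finite B]
    (φ : G →* AddMonoid.End B) : Finite (AuxDer φ) := by
  unfold AuxDer; infer_instance

theorem AuxDer.one {G B : Type*} [Group G] [AddCommGroup B] {φ : G →* AddMonoid.End B}
    (d : AuxDer φ) : d.1 1 = 0 := by
  have := d.2 1 1
  simpa using this

theorem AuxDer.ext_closure {G B : Type*} [Group G] [AddCommGroup B] {φ : G →* AddMonoid.End B}
    (d e : AuxDer φ) (T : Set G) (hT : Subgroup.closure T = ⊤) (h : ∀ t ∈ T, d.1 t = e.1 t) :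
    d = e := by
  apply Subtype.ext
  funext g
  have hg : g ∈ Subgroup.closure T := by rw [hT]; trivial
  induction hg using Subgroup.closure_induction with
  | mem x hx => exact h x hx
  | one => rw [d.one, e.one]
  | mul x y _ _ hx hy => rw [d.2, e.2, hx, hy]
  | inv x _ hx =>
    have h1 := d.2 x⁻¹ x
    have h2 := e.2 x⁻¹ x
    rw [inv_mul_cancel, d.one] at h1
    rw [inv_mul_cancel, e.one, ← hx] at h2
    exact add_right_cancel (h1.symm.trans h2)

def AuxDer.res {G B : Type*} [Group G] [AddCommGroup B] {φ : G →* AddMonoid.End B}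
    (d : AuxDer φ) (H : Subgroup G) : AuxDer (φ.comp H.subtype) :=
  ⟨fun h => d.1 h, fun g h => d.2 g h⟩

theorem aux_hom {p : ℕ} [hp : Fact p.Prime] {B : Type*} [AddCommGroup B] [Finite B] {r : ℕ}
    (hB : AuxGen r B) (m : ℕ) : ∀ (C : Type u) [Group C] [Finite C], IsPGroup p C →
    Nat.card C = m → Nat.card (C →* Multiplicative B) ≤ m ^ r := by
  classical
  induction m using Nat.strong_induction_on with
  | _ m ih =>
  intro C _ _ hC hm
  rcases subsingleton_or_nontrivial C with hs | hnt
  · have : Subsingleton (C →* Multiplicative B) := ⟨fun f g => by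
      refine MonoidHom.ext fun x => ?_
      rw [Subsingleton.elim x 1, map_one, map_one]⟩
    have h1 : Nat.card (C →* Multiplicative B) ≤ 1 := Finite.card_le_one_iff_subsingleton.2 this
    have h2 : 0 < m := hm ▸ Nat.card_pos
    exact h1.trans (Nat.one_le_pow _ _ h2)
  obtain ⟨M, hM, -⟩ := (eq_top_or_exists_le_coatom (⊥ : Subgroup C)).resolve_left bot_ne_top
  obtain ⟨g, hg⟩ : ∃ g, g ∉ M := by
    by_contra! hc
    exact hM.1 (by ext x; simp [hc x])
  have hpi : p ≤ M.index := by
    obtain ⟨n, hn⟩ := hC.index M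
    rw [hn]
    rcases Nat.eq_zero_or_pos n with h | h
    · subst h
      exact absurd (Subgroup.index_eq_one.1 (by simpa using hn)) hM.1
    · exact Nat.le_self_pow h.ne' p
  have hcard := Subgroup.card_mul_index M
  rw [hm] at hcard
  have hMpos : 0 < Nat.card M := Nat.card_pos
  have hlt : Nat.card M < m := by
    have := hp.out.two_le
    nlinarith
  have hIH := ih _ hlt M (hC.to_subgroup M) rfl
  have hfin : Finite (C →* Multiplicative B) := Finite.of_injective _ DFunLike.coe_injective
  have hfin' : Finite (M →* Multiplicative B) := Finite.of_injective _ DFunLike.coe_injective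
  have hfib : Nat.card (C →* Multiplicative B) ≤ Nat.card (M →* Multiplicative B) * p ^ r := by
    refine aux_fiber (fun f => f.comp M.subtype) _ ?_
    intro b
    by_cases hb : IsEmpty {a : C →* Multiplicative B // a.comp M.subtype = b}
    · simp
    rw [not_isEmpty_iff] at hb
    obtain ⟨⟨f0, hf0⟩⟩ := hb
    refine le_trans ?_ (hB.tors p hp.out.pos)
    have hagree : ∀ f : {a : C →* Multiplicative B // a.comp M.subtype = b}, ∀ x ∈ M,
        f.1 x = f0 x := fun f x hx =>
      DFunLike.congr_fun (f.2.trans hf0.symm) (⟨x, hx⟩ : M)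
    refine Nat.card_le_card_of_injective
      (fun f => ⟨Multiplicative.toAdd (f.1 g / f0 g), ?_⟩) ?_
    · rw [← toAdd_pow, div_pow, ← map_pow, ← map_pow, hagree f _ (aux_coatom hC M hM g)]
      simp
    · intro f f' hff
      have h5 := Subtype.mk.inj hff
      have h6 : f.1 g = f'.1 g := by
        have := Multiplicative.toAdd.injective h5
        exact div_left_injective this
      have htop : M ⊔ Subgroup.zpowers g = ⊤ := by
        refine hM.2 _ (lt_of_le_of_ne le_sup_left fun h => hg ?_)
        rw [h]
        exact (le_sup_right : Subgroup.zpowers g ≤ _) (Subgroup.mem_zpowers _)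
      apply Subtype.ext
      have hle : M ⊔ Subgroup.zpowers g ≤ f.1.eqLocus f'.1 := by
        refine sup_le (fun x hx => ?_) ?_
        · exact (hagree f x hx).trans (hagree f' x hx).symm
        · rw [Subgroup.zpowers_le]; exact h6
      rw [htop] at hle
      ext x
      exact congrArg _ (hle (Subgroup.mem_top x))
  calc _ ≤ Nat.card (M →* Multiplicative B) * p ^ r := hfib
    _ ≤ Nat.card M ^ r * M.index ^ r := Nat.mul_le_mul hIH (Nat.pow_le_pow_left hpi r)
    _ = m ^ r := by rw [← mul_pow, hcard]

theorem aux_der_p {p : ℕ} [hp : Fact p.Prime] {B : Type*} [AddCommGroup B] [Finite B]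
    [Nontrivial B] {r n : ℕ} (hB : AuxGen r B) (hBn : Nat.card B = p ^ n)
    {P : Type*} [Group P] [Finite P] (hP : IsPGroup p P) (φ : P →* AddMonoid.End B) :
    Nat.card (AuxDer φ) ≤ Nat.card B ^ (3 * r ^ 2 - 1) * Nat.card P ^ r := by
  classical
  have hfE : Finite (AddMonoid.End B) := Finite.of_injective _ DFunLike.coe_injective
  have hntE : Nontrivial (AddMonoid.End B) := by
    obtain ⟨b, hb⟩ := exists_ne (0 : B)
    exact ⟨⟨1, 0, fun h => hb (DFunLike.congr_fun h b)⟩⟩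
  have hp0 : ((p : AddMonoid.End B)) ^ n = 0 := by
    rw [← Nat.cast_pow, ← hBn]
    ext b
    simp [AddMonoid.End.natCast_apply]
  have h1 := hB.endTors p hp.out.pos
  have h2 := hB.endTors (p ^ 2) (pow_pos hp.out.pos 2)
  rw [← pow_mul] at h2
  set C := φ.toHomUnits.ker with hC
  obtain ⟨S, hS, hSc⟩ := aux_gen n (r * r) hp0 h1 h2
    (hP.to_quotient C)
    ((Units.coeHom _).comp (QuotientGroup.kerLift φ.toHomUnits))
    (Units.val_injective.comp (QuotientGroup.kerLift_injective _))
  have hCt : ∀ c ∈ C, φ c = 1 := by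
    intro c hc
    have := congrArg Units.val (MonoidHom.mem_ker.1 hc)
    simpa using this
  let S' : Finset P := S.image Quotient.out
  have hS' : S'.card ≤ 3 * r ^ 2 - 1 := by
    rw [pow_two]; exact Finset.card_image_le.trans hS
  have hgen : Subgroup.closure ((S' : Set P) ∪ C) = ⊤ := by
    rw [Subgroup.closure_union, Subgroup.closure_eq]
    have hm : (Subgroup.closure (S' : Set P)).map (QuotientGroup.mk' C) = ⊤ := by
      rw [MonoidHom.map_closure, ← hSc]
      congr 1
      ext x
      simp [S']
    have := congrArg (Subgroup.comap (QuotientGroup.mk' C)) hm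
    rwa [Subgroup.comap_map_eq, QuotientGroup.ker_mk', Subgroup.comap_top] at this
  have hfinC : Finite (C →* Multiplicative B) := Finite.of_injective _ DFunLike.coe_injective
  let F : AuxDer φ → (S' → B) × (C →* Multiplicative B) := fun d =>
    (fun i => d.1 i,
      MonoidHom.mk' (fun c => Multiplicative.ofAdd (d.1 c)) (by
        intro a b
        rw [← ofAdd_add, Subgroup.coe_mul, d.2, hCt a a.2]; rfl))
  have hF : Function.Injective F := by
    intro d e hde
    refine d.ext_closure e _ hgen ?_
    rintro t (ht | ht)
    · exact congrFun (congrArg Prod.fst hde) ⟨t, ht⟩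
    · exact DFunLike.congr_fun (congrArg Prod.snd hde) (⟨t, ht⟩ : C)
  refine (Nat.card_le_card_of_injective F hF).trans ?_
  rw [Nat.card_prod, Nat.card_fun]
  refine Nat.mul_le_mul ?_ ?_
  · refine Nat.pow_le_pow_right Nat.card_pos ?_
    simpa using hS'
  · exact (aux_hom hB _ C (hP.to_subgroup C) rfl).trans
      (Nat.pow_le_pow_left (Subgroup.card_le_card_group C) r)

theorem aux_inner {p : ℕ} [hp : Fact p.Prime] {B : Type*} [AddCommGroup B] [Finite B]
    {n : ℕ} (hBn : Nat.card B = p ^ n)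
    {G : Type*} [Group G] [Finite G] (P : Sylow p G) (φ : G →* AddMonoid.End B)
    (e : G → B) (he : ∀ g h, e (g * h) = e g + φ g (e h)) (h0 : ∀ x ∈ P, e x = 0) :
    ∃ b : B, ∀ g, e g = b - φ g b := by
  classical
  have _i := Fintype.ofFinite (G ⧸ (P : Subgroup G))
  let f : G ⧸ (P : Subgroup G) → B := Quotient.lift e (by
    intro a b hab
    have hab' := QuotientGroup.leftRel_apply.1 hab
    have : b = a * (a⁻¹ * b) := by group
    rw [this, he, h0 _ hab', map_zero, add_zero])
  have hf : ∀ g q, f (g • q) = e g + φ g (f q) := by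
    intro g q
    induction q using Quotient.inductionOn with
    | _ x => exact he g x
  set s := ∑ q, f q with hs
  have hsum : ∀ g, s = (P : Subgroup G).index • e g + φ g s := by
    intro g
    have h4 : s = ∑ q, f (g • q) := (Equiv.sum_comp (MulAction.toPerm g) f).symm
    rw [Subgroup.index, Nat.card_eq_fintype_card]
    refine h4.trans ?_
    rw [hs, map_sum]
    simp only [hf, Finset.sum_add_distrib, Finset.sum_const, Finset.card_univ]
  have hco : IsCoprime ((P : Subgroup G).index : ℤ) ((p ^ n : ℕ) : ℤ) := by
    rw [Nat.isCoprime_iff_coprime]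
    apply Nat.Coprime.pow_right
    exact ((hp.out.coprime_iff_not_dvd).2 P.not_dvd_index).symm
  obtain ⟨u, v, huv⟩ := hco
  refine ⟨u • s, fun g => ?_⟩
  have h3 : (p ^ n) • e g = 0 := by rw [← hBn]; exact card_nsmul_eq_zero'
  calc e g = (u * ((P : Subgroup G).index : ℤ) + v * ((p ^ n : ℕ) : ℤ)) • e g := by
        rw [huv, one_smul]
    _ = u • ((P : Subgroup G).index • e g) := by
        rw [add_smul, mul_smul, mul_smul, natCast_zsmul, natCast_zsmul, h3, smul_zero, add_zero]
    _ = _ := by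
        rw [map_zsmul, ← smul_sub]
        congr 1
        rw [eq_sub_iff_add_eq, ← hsum g]

theorem aux_der_sylow {p : ℕ} [hp : Fact p.Prime] {B : Type*} [AddCommGroup B] [Finite B]
    {r n : ℕ} (hB : AuxGen r B) (hBn : Nat.card B = p ^ n) (hn : 0 < n)
    {G : Type*} [Group G] [Finite G] (φ : G →* AddMonoid.End B) :
    Nat.card (AuxDer φ) ≤ Nat.card B ^ (3 * r ^ 2) * (p ^ (Nat.card G).factorization p) ^ r := by
  classical
  have hnt : Nontrivial B := by
    rw [← Finite.one_lt_card_iff_nontrivial, hBn]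
    exact Nat.one_lt_pow hn.ne' hp.out.one_lt
  have hr : 0 < r := by
    rcases Nat.eq_zero_or_pos r with h | h
    · exfalso
      subst h
      obtain ⟨S, hS, hc⟩ := hB
      have hS0 : S = ∅ := by simpa using hS
      rw [hS0] at hc
      simp only [Finset.coe_empty, AddSubgroup.closure_empty] at hc
      exact bot_ne_top hc
    · exact h
  let P : Sylow p G := default
  have hres : Nat.card (AuxDer φ) ≤
      Nat.card (AuxDer (φ.comp (P : Subgroup G).subtype)) * Nat.card B := by
    refine aux_fiber (fun d => d.res (P : Subgroup G)) _ ?_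
    intro b
    by_cases hb : IsEmpty {a : AuxDer φ // a.res (P : Subgroup G) = b}
    · simp
    rw [not_isEmpty_iff] at hb
    obtain ⟨⟨d0, hd0⟩⟩ := hb
    have hin : ∀ d : {a : AuxDer φ // a.res (P : Subgroup G) = b},
        ∃ b : B, ∀ g, d.1.1 g - d0.1 g = b - φ g b := by
      intro d
      refine aux_inner hBn P φ (fun g => d.1.1 g - d0.1 g) ?_ ?_
      · intro g h
        simp only [d.1.2, d0.2, map_sub]
        abel
      · intro x hx
        rw [sub_eq_zero]
        exact congrFun (congrArg Subtype.val (d.2.trans hd0.symm)) (⟨x, hx⟩ : (P : Subgroup G))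
    choose β hβ using hin
    refine Nat.card_le_card_of_injective β ?_
    intro d d' hdd
    apply Subtype.ext
    apply Subtype.ext
    funext g
    have h1 := hβ d g
    rw [hdd, ← hβ d' g] at h1
    exact sub_left_injective h1
  have h2 := aux_der_p hB hBn P.isPGroup' (φ.comp (P : Subgroup G).subtype)
  rw [P.card_eq_multiplicity] at h2
  refine hres.trans ((Nat.mul_le_mul_right _ h2).trans ?_)
  have h3 : 3 * r ^ 2 = (3 * r ^ 2 - 1) + 1 := by
    have : 0 < r ^ 2 := by positivity
    omega
  conv_rhs => rw [h3, pow_succ]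
  apply le_of_eq
  ring

def auxQuot {G B : Type*} [Group G] [AddCommGroup B] (φ : G →* AddMonoid.End B)
    (R : AddSubgroup B) (h : ∀ g, R ≤ R.comap (φ g)) : G →* AddMonoid.End (B ⧸ R) where
  toFun g := QuotientAddGroup.map R R (φ g) (h g)
  map_one' := by
    refine AddMonoidHom.ext fun x => ?_
    induction x using QuotientAddGroup.induction_on with
    | H x => simp; rfl
  map_mul' a b := by
    refine AddMonoidHom.ext fun x => ?_
    induction x using QuotientAddGroup.induction_on with
    | H x => simp; rfl

def AuxDer.quot {G B : Type*} [Group G] [AddCommGroup B] {φ : G →* AddMonoid.End B}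
    (d : AuxDer φ) (R : AddSubgroup B) (h : ∀ g, R ≤ R.comap (φ g)) : AuxDer (auxQuot φ R h) :=
  ⟨fun g => QuotientAddGroup.mk (d.1 g), fun g k => by
    exact congrArg (QuotientAddGroup.mk (s := R)) (d.2 g k)⟩

theorem aux_der_all {G : Type*} [Group G] [Finite G] (r N : ℕ) :
    ∀ (B : Type u) [AddCommGroup B] [Finite B], Nat.card B = N → AuxGen r B →
    ∀ φ : G →* AddMonoid.End B, Nat.card (AuxDer φ) ≤ N ^ (3 * r ^ 2) *
      (∏ q ∈ N.primeFactors, q ^ (Nat.card G).factorization q) ^ r := by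
  classical
  induction N using Nat.recOnPosPrimePosCoprime with
  | zero => intro B _ _ h; exact absurd h Nat.card_pos.ne'
  | one =>
    intro B _ _ h _ φ
    have hs : Subsingleton B := (Nat.card_eq_one_iff_unique.1 h).1
    have : Subsingleton (AuxDer φ) := ⟨fun d e => Subtype.ext (Subsingleton.elim _ _)⟩
    simpa using Finite.card_le_one_iff_subsingleton.2 this
  | prime_pow p n hp hn =>
    intro B _ _ h hB φ
    have _i : Fact p.Prime := ⟨hp⟩
    have := aux_der_sylow hB h hn φ
    rw [h] at this
    rwa [Nat.primeFactors_prime_pow hn.ne' hp, Finset.prod_singleton]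
  | coprime a b ha hb hab iha ihb =>
    intro B _ _ h hB φ
    let R : ℕ → AddSubgroup B := fun n => (nsmulAddMonoidHom (α := B) n).range
    have hR : ∀ n g, R n ≤ (R n).comap (φ g) := by
      rintro n g _ ⟨y, rfl⟩
      exact ⟨φ g y, (map_nsmul (φ g) n y).symm⟩
    have hkill : ∀ n, ∀ y : B ⧸ R n, n • y = 0 := by
      intro n y
      induction y using QuotientAddGroup.induction_on with
      | H x => exact (QuotientAddGroup.eq_zero_iff _).2 ⟨x, rfl⟩
    have hcop : ∀ m n : ℕ, Nat.Coprime m n → Nat.Coprime (Nat.card (B ⧸ R m)) n := by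
      intro m n hmn
      refine Nat.Coprime.symm (Nat.coprime_of_dvd ?_)
      intro q hq hqn hqc
      have _i : Fact q.Prime := ⟨hq⟩
      obtain ⟨x, hx⟩ := exists_prime_addOrderOf_dvd_card' q hqc
      have := addOrderOf_dvd_of_nsmul_eq_zero (hkill m x)
      rw [hx] at this
      exact hq.one_lt.ne' (Nat.dvd_one.1 (hmn ▸ Nat.dvd_gcd this hqn))
    have hdvd : ∀ m, Nat.card (B ⧸ R m) ∣ a * b := by
      intro m
      rw [← h]
      exact AddSubgroup.card_quotient_dvd_card _
    have hda : Nat.card (B ⧸ R a) ∣ a := (hcop a b hab).dvd_of_dvd_mul_right (hdvd a)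
    have hdb : Nat.card (B ⧸ R b) ∣ b := (hcop b a hab.symm).dvd_of_dvd_mul_left (hdvd b)
    have hinj : ∀ x : B, x ∈ R a → x ∈ R b → x = 0 := by
      rintro x ⟨y, hy⟩ ⟨z, hz⟩
      simp only [nsmulAddMonoidHom_apply] at hy hz
      obtain ⟨u, v, huv⟩ := (Nat.isCoprime_iff_coprime.2 hab)
      have hk : ∀ w : B, (a * b) • w = 0 := fun w => by rw [← h]; exact card_nsmul_eq_zero'
      have e1 : a • x = 0 := by rw [← hz, smul_smul, hk]
      have e2 : b • x = 0 := by rw [← hy, smul_smul, mul_comm, hk]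
      calc x = (u * (a : ℤ) + v * (b : ℤ)) • x := by rw [huv, one_smul]
        _ = 0 := by rw [add_smul, mul_smul, mul_smul, natCast_zsmul, natCast_zsmul, e1, e2]; simp
    have hinj2 : Function.Injective
        (fun x : B => ((x : B ⧸ R a), (x : B ⧸ R b))) := by
      intro x y hxy
      have h1 := QuotientAddGroup.eq.1 (congrArg Prod.fst hxy)
      have h2 := QuotientAddGroup.eq.1 (congrArg Prod.snd hxy)
      have := hinj _ h1 h2
      rwa [neg_add_eq_zero] at this
    have hle : a * b ≤ Nat.card (B ⧸ R a) * Nat.card (B ⧸ R b) := by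
      rw [← h, ← Nat.card_prod]
      exact Nat.card_le_card_of_injective _ hinj2
    have hca : Nat.card (B ⧸ R a) = a := by
      have h1 := Nat.le_of_dvd (by omega) hda
      have h2 := Nat.le_of_dvd (by omega) hdb
      refine le_antisymm h1 ?_
      have h3 := hle.trans (Nat.mul_le_mul_left _ h2)
      exact Nat.le_of_mul_le_mul_right h3 (by omega)
    have hcb : Nat.card (B ⧸ R b) = b := by
      have h1 := Nat.le_of_dvd (by omega) hda
      have h2 := Nat.le_of_dvd (by omega) hdb
      refine le_antisymm h2 ?_
      have h3 := hle.trans (Nat.mul_le_mul_right _ h1)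
      exact Nat.le_of_mul_le_mul_left h3 (by omega)
    have ia := iha (B ⧸ R a) hca
      (hB.surj (QuotientAddGroup.mk' (R a)) (QuotientAddGroup.mk'_surjective _))
      (auxQuot φ (R a) (hR a))
    have ib := ihb (B ⧸ R b) hcb
      (hB.surj (QuotientAddGroup.mk' (R b)) (QuotientAddGroup.mk'_surjective _))
      (auxQuot φ (R b) (hR b))
    have hD : Nat.card (AuxDer φ) ≤
        Nat.card (AuxDer (auxQuot φ (R a) (hR a))) * Nat.card (AuxDer (auxQuot φ (R b) (hR b))) := by
      rw [← Nat.card_prod]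
      refine Nat.card_le_card_of_injective
        (fun d => (d.quot (R a) (hR a), d.quot (R b) (hR b))) ?_
      intro d e hde
      apply Subtype.ext
      funext g
      apply hinj2
      exact Prod.ext (congrFun (congrArg Subtype.val (congrArg Prod.fst hde)) g)
        (congrFun (congrArg Subtype.val (congrArg Prod.snd hde)) g)
    refine hD.trans ((Nat.mul_le_mul ia ib).trans (le_of_eq ?_))
    rw [Nat.Coprime.primeFactors_mul hab, Finset.prod_union hab.disjoint_primeFactors, mul_pow,
      mul_pow]
    ring

theorem aux_prod_le (m n : ℕ) (hm : m ≠ 0) :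
    ∏ q ∈ n.primeFactors, q ^ m.factorization q ≤ m := by
  classical
  apply Nat.le_of_dvd (Nat.pos_of_ne_zero hm)
  have h1 : ∏ q ∈ n.primeFactors, q ^ m.factorization q =
      ∏ q ∈ n.primeFactors ∩ m.primeFactors, q ^ m.factorization q := by
    symm
    apply Finset.prod_subset Finset.inter_subset_left
    intro x hx hx'
    have : x ∉ m.factorization.support := by
      rw [Nat.support_factorization]
      intro h
      exact hx' (Finset.mem_inter.2 ⟨hx, h⟩)
    rw [Finsupp.notMem_support_iff.1 this, pow_zero]
  rw [h1]
  conv_rhs => rw [← Nat.prod_factorization_pow_eq_self hm]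
  exact Finset.prod_dvd_prod_of_subset _ _ _ Finset.inter_subset_right

theorem aux_der {G B : Type*} [Group G] [Finite G] [AddCommGroup B] [Finite B] (r : ℕ)
    (hB : AuxGen r B) (φ : G →* AddMonoid.End B) :
    Nat.card (AuxDer φ) ≤ Nat.card B ^ (3 * r ^ 2) * Nat.card G ^ r :=
  (aux_der_all r _ B rfl hB φ).trans
    (Nat.mul_le_mul_left _ (Nat.pow_le_pow_left (aux_prod_le _ _ Nat.card_pos.ne') r))

theorem aux_count_sub {U : Type*} [Group U] [Finite U] (A : Subgroup U) (r : ℕ)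
    (hr : ∀ H : Subgroup U, H ≤ A → ∃ S : Finset U, S.card ≤ r ∧
      Subgroup.closure (S : Set U) = H) :
    Nat.card {M : Subgroup U // M ≤ A} ≤ Nat.card A ^ r := by
  classical
  have h1 : Nat.card (Fin r → A) = Nat.card A ^ r := by simp [Nat.card_fun]
  rw [← h1]
  refine Nat.card_le_card_of_surjective
    (fun c : Fin r → A => (⟨Subgroup.closure (Set.range fun i => (c i : U)), by
      rw [Subgroup.closure_le]
      rintro _ ⟨i, rfl⟩
      exact (c i).2⟩ : {M : Subgroup U // M ≤ A})) ?_
  rintro ⟨M, hM⟩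
  obtain ⟨S, hS, hc⟩ := hr M hM
  have hSM : ∀ x ∈ S, x ∈ M := fun x hx => hc ▸ Subgroup.subset_closure hx
  refine ⟨fun i => if h : (i : ℕ) < S.card then
    ⟨(S.equivFin.symm ⟨i, h⟩ : S), hM (hSM _ (S.equivFin.symm ⟨i, h⟩).2)⟩ else 1, ?_⟩
  apply Subtype.ext
  apply le_antisymm
  · show Subgroup.closure _ ≤ M
    rw [Subgroup.closure_le]
    rintro _ ⟨i, rfl⟩
    dsimp only
    split_ifs with h
    · exact hSM _ (S.equivFin.symm ⟨i, h⟩).2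
    · exact M.one_mem
  · show M ≤ Subgroup.closure _
    conv_lhs => rw [← hc]
    apply Subgroup.closure_mono
    intro x hx
    have hi := (S.equivFin ⟨x, hx⟩).2
    refine ⟨⟨S.equivFin ⟨x, hx⟩, by omega⟩, ?_⟩
    simp

theorem aux_fiber_M {U : Type*} [Group U] [Finite U] (A : Subgroup U) [hA : A.Normal] (r : ℕ)
    (hcomm : ∀ a ∈ A, ∀ b ∈ A, a * b = b * a)
    (hr : ∃ S : Finset U, S.card ≤ r ∧ Subgroup.closure (S : Set U) = A)
    (M H0 : Subgroup U) (hM : H0 ⊓ A = M) :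
    Nat.card {H : Subgroup U // H ⊔ A = H0 ⊔ A ∧ H ⊓ A = M} * Nat.card A ^ r ≤
      Nat.card A ^ (3 * r ^ 2) * Nat.card U ^ r := by
  classical
  let _iA : CommGroup A := { (inferInstance : Group A) with
    mul_comm := fun a b => Subtype.ext (hcomm a a.2 b b.2) }
  let ψ : H0 →* AddMonoid.End (Additive A) :=
    { toFun := fun h => MonoidHom.toAdditive (MulAut.conjNormal (H := A) (h : U)).toMonoidHom
      map_one' := by
        refine AddMonoidHom.ext fun x => ?_
        apply Additive.toMul.injective
        simp
        rfl
      map_mul' := by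
        intro a b
        refine AddMonoidHom.ext fun x => ?_
        apply Additive.toMul.injective
        simp
        rfl }
  have hψ : ∀ (h : H0) (a : A), ((Additive.toMul (ψ h (Additive.ofMul a)) : A) : U)
      = h * a * (h : U)⁻¹ := fun h a => MulAut.conjNormal_apply (h : U) a
  let R : AddSubgroup (Additive A) := Subgroup.toAddSubgroup (M.subgroupOf A)
  have memR : ∀ a : A, Additive.ofMul a ∈ R ↔ (a : U) ∈ M := fun a => Iff.rfl
  have hR : ∀ g, R ≤ R.comap (ψ g) := by
    intro g x hx
    have hx' : ((Additive.toMul x : A) : U) ∈ M := hx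
    show ((Additive.toMul (ψ g x) : A) : U) ∈ M
    have h1 := hψ g (Additive.toMul x)
    rw [← hM] at hx' ⊢
    refine ⟨?_, (Additive.toMul (ψ g x) : A).2⟩
    have h2 : ((Additive.toMul (ψ g x) : A) : U) = g * (Additive.toMul x : A) * (g : U)⁻¹ := h1
    rw [h2]
    exact H0.mul_mem (H0.mul_mem g.2 hx'.1) (H0.inv_mem g.2)
  have hgen : AuxGen r (Additive A) := by
    obtain ⟨S, hS, hc⟩ := hr
    have hSA : ∀ x ∈ S, x ∈ A := fun x hx => hc ▸ Subgroup.subset_closure hx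
    refine ⟨S.attach.image (fun x => Additive.ofMul (⟨x.1, hSA _ x.2⟩ : A)),
      Finset.card_image_le.trans (by simpa using hS), ?_⟩
    rw [eq_top_iff]
    have key : ∀ x : U, ∀ hx : x ∈ Subgroup.closure (S : Set U), ∃ h : x ∈ A,
        Additive.ofMul (⟨x, h⟩ : A) ∈ AddSubgroup.closure
          ((S.attach.image (fun x => Additive.ofMul (⟨x.1, hSA _ x.2⟩ : A)) :
            Finset (Additive A)) : Set (Additive A)) := by
      intro x hx
      induction hx using Subgroup.closure_induction with
      | mem x hx => exact ⟨hSA x hx, AddSubgroup.subset_closure (by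
          simp only [Finset.coe_image, Set.mem_image]
          exact ⟨⟨x, hx⟩, by simp, rfl⟩)⟩
      | one => exact ⟨A.one_mem, AddSubgroup.zero_mem _⟩
      | mul x y _ _ hx hy =>
        obtain ⟨h1, h2⟩ := hx
        obtain ⟨h3, h4⟩ := hy
        exact ⟨A.mul_mem h1 h3, AddSubgroup.add_mem _ h2 h4⟩
      | inv x _ hx =>
        obtain ⟨h1, h2⟩ := hx
        exact ⟨A.inv_mem h1, AddSubgroup.neg_mem _ h2⟩
    intro x _
    obtain ⟨_, h⟩ := key (Additive.toMul x : A) (by rw [hc]; exact (Additive.toMul x : A).2)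
    exact h
  have hgenB := hgen.surj (QuotientAddGroup.mk' R) (QuotientAddGroup.mk'_surjective _)
  have hder := aux_der r hgenB (auxQuot ψ R hR)
  have hex : ∀ H : {H : Subgroup U // H ⊔ A = H0 ⊔ A ∧ H ⊓ A = M}, ∀ h : H0,
      ∃ a : A, (a : U) * h ∈ H.1 := by
    intro H h
    have h1 : (h : U) ∈ A ⊔ H.1 := by
      rw [sup_comm, H.2.1]
      exact (le_sup_left : H0 ≤ _) h.2
    obtain ⟨y, hy, z, hz, hyz⟩ := Subgroup.mem_sup_of_normal_left.1 h1
    refine ⟨⟨y⁻¹, A.inv_mem hy⟩, ?_⟩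
    simp only [← hyz]
    simpa using hz
  choose α hα using hex
  have huniq : ∀ H : {H : Subgroup U // H ⊔ A = H0 ⊔ A ∧ H ⊓ A = M}, ∀ h : U, ∀ a b : A,
      (a : U) * h ∈ H.1 → (b : U) * h ∈ H.1 →
      (QuotientAddGroup.mk (Additive.ofMul a) : Additive A ⧸ R)
        = QuotientAddGroup.mk (Additive.ofMul b) := by
    intro H h a b ha hb
    refine QuotientAddGroup.eq.2 ?_
    have h1 : (b : U) * (a : U)⁻¹ ∈ M := by
      rw [← H.2.2]
      refine ⟨?_, A.mul_mem b.2 (A.inv_mem a.2)⟩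
      have := H.1.mul_mem hb (H.1.inv_mem ha)
      have e : (b : U) * h * ((a : U) * h)⁻¹ = (b : U) * (a : U)⁻¹ := by group
      rwa [e] at this
    have h2 : ((a⁻¹ * b : A) : U) ∈ M := by
      rw [mul_comm]; exact h1
    exact h2
  let D : {H : Subgroup U // H ⊔ A = H0 ⊔ A ∧ H ⊓ A = M} → AuxDer (auxQuot ψ R hR) := fun H =>
    ⟨fun h => QuotientAddGroup.mk (Additive.ofMul (α H h)), fun g h => by
      have h1 : ((α H g * Additive.toMul (ψ g (Additive.ofMul (α H h))) : A) : U) * (g * h : H0)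
          ∈ H.1 := by
        rw [Subgroup.coe_mul, hψ]
        have e : (α H g : U) * (g * (α H h : U) * (g : U)⁻¹) * ((g * h : H0) : U)
          = ((α H g : U) * g) * ((α H h : U) * h) := by
            rw [Subgroup.coe_mul]; group
        rw [e]
        exact H.1.mul_mem (hα H g) (hα H h)
      exact huniq H _ _ _ (hα H (g * h)) h1⟩
  have hDinj : ∀ H H', D H = D H' → H.1 ≤ H'.1 := by
    intro H H' hDD x hx
    have h1 : x ∈ A ⊔ H0 := by
      rw [sup_comm, ← H.2.1]
      exact (le_sup_left : H.1 ≤ _) hx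
    obtain ⟨y, hy, z, hz, hyz⟩ := Subgroup.mem_sup_of_normal_left.1 h1
    have h2 : (QuotientAddGroup.mk (Additive.ofMul (⟨y, hy⟩ : A)) : Additive A ⧸ R) =
        QuotientAddGroup.mk (Additive.ofMul (α H ⟨z, hz⟩)) :=
      huniq H z _ _ (by simpa [hyz] using hx) (hα H ⟨z, hz⟩)
    have h3 : (QuotientAddGroup.mk (Additive.ofMul (α H ⟨z, hz⟩)) : Additive A ⧸ R) =
        QuotientAddGroup.mk (Additive.ofMul (α H' ⟨z, hz⟩)) :=
      congrFun (congrArg Subtype.val hDD) ⟨z, hz⟩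
    have h4 := QuotientAddGroup.eq.1 (h2.trans h3).symm
    have h5 : (((α H' ⟨z, hz⟩)⁻¹ * (⟨y, hy⟩ : A) : A) : U) ∈ M := h4
    rw [mul_comm, ← H'.2.2] at h5
    have h6 := H'.1.mul_mem h5.1 (hα H' ⟨z, hz⟩)
    simpa [hyz] using h6
  have hDinj' : Function.Injective D := fun H H' h =>
    Subtype.ext (le_antisymm (hDinj H H' h) (hDinj H' H h.symm))
  have hf := (Nat.card_le_card_of_injective D hDinj').trans hder
  have hcardB : Nat.card M * Nat.card (Additive A ⧸ R) = Nat.card A := by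
    have h1 := AddSubgroup.card_mul_index R
    have h2 : Nat.card R = Nat.card M := by
      refine Nat.card_congr
        { toFun := fun x => ⟨((Additive.toMul x.1 : A) : U), x.2⟩
          invFun := fun m => ⟨Additive.ofMul (⟨m.1, (hM ▸ m.2 : m.1 ∈ H0 ⊓ A).2⟩ : A), m.2⟩
          left_inv := fun x => rfl
          right_inv := fun x => rfl }
    rw [h2] at h1
    exact h1
  have hH0 : Nat.card H0 * Nat.card A ≤ Nat.card M * Nat.card U := by
    have h1 := Subgroup.card_mul_index (A.subgroupOf H0)
    have h2 : Nat.card (A.subgroupOf H0) ≤ Nat.card M := by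
      refine Nat.card_le_card_of_injective
        (fun x => (⟨x.1.1, hM ▸ ⟨x.1.2, x.2⟩⟩ : M)) ?_
      intro x y hxy
      exact Subtype.ext (Subtype.ext (Subtype.mk.inj hxy))
    have h3 : (A.subgroupOf H0).index ≤ A.index :=
      Nat.le_of_dvd (Nat.pos_of_ne_zero Subgroup.FiniteIndex.index_ne_zero)
        (Subgroup.relIndex_dvd_index_of_normal A H0)
    rw [← h1, ← Subgroup.card_mul_index A]
    calc _ ≤ Nat.card M * A.index * Nat.card A :=
          Nat.mul_le_mul_right _ (Nat.mul_le_mul h2 h3)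
      _ = _ := by ring
  have hrr : r ≤ 3 * r ^ 2 := by nlinarith [Nat.le_self_pow (n := 2) (by norm_num) r]
  have hMp : 0 < Nat.card M := Nat.card_pos
  calc _ ≤ Nat.card (Additive A ⧸ R) ^ (3 * r ^ 2) * Nat.card H0 ^ r * Nat.card A ^ r :=
        Nat.mul_le_mul_right _ hf
    _ = Nat.card (Additive A ⧸ R) ^ (3 * r ^ 2) * (Nat.card H0 * Nat.card A) ^ r := by
        rw [mul_pow]; ring
    _ ≤ Nat.card (Additive A ⧸ R) ^ (3 * r ^ 2) * (Nat.card M * Nat.card U) ^ r :=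
        Nat.mul_le_mul_left _ (Nat.pow_le_pow_left hH0 r)
    _ = Nat.card (Additive A ⧸ R) ^ (3 * r ^ 2) * Nat.card M ^ r * Nat.card U ^ r := by
        rw [mul_pow]; ring
    _ ≤ Nat.card (Additive A ⧸ R) ^ (3 * r ^ 2) * Nat.card M ^ (3 * r ^ 2) * Nat.card U ^ r :=
        Nat.mul_le_mul_right _ (Nat.mul_le_mul_left _ (Nat.pow_le_pow_right hMp hrr))
    _ = _ := by rw [← mul_pow, mul_comm (Nat.card (Additive A ⧸ R)), hcardB]

theorem aux_fiber_X {U : Type*} [Group U] [Finite U] (A : Subgroup U) [hA : A.Normal] (r : ℕ)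
    (hcomm : ∀ a ∈ A, ∀ b ∈ A, a * b = b * a)
    (hr : ∀ H : Subgroup U, H ≤ A → ∃ S : Finset U, S.card ≤ r ∧
      Subgroup.closure (S : Set U) = H) (X : Subgroup U) :
    Nat.card {H : Subgroup U // H ⊔ A = X} ≤ Nat.card A ^ (3 * r ^ 2) * Nat.card U ^ r := by
  set T := Nat.card A ^ (3 * r ^ 2) * Nat.card U ^ r with hT
  have hApos : 0 < Nat.card A ^ r := pow_pos Nat.card_pos r
  have h1 : Nat.card {H : Subgroup U // H ⊔ A = X} ≤
      Nat.card {M : Subgroup U // M ≤ A} * (T / Nat.card A ^ r) := by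
    refine aux_fiber (fun H => (⟨H.1 ⊓ A, inf_le_right⟩ : {M : Subgroup U // M ≤ A})) _ ?_
    intro M
    by_cases hb : IsEmpty {H : {H : Subgroup U // H ⊔ A = X} //
        (⟨H.1 ⊓ A, inf_le_right⟩ : {M : Subgroup U // M ≤ A}) = M}
    · simp
    rw [not_isEmpty_iff] at hb
    obtain ⟨⟨⟨H0, hH0⟩, hH0M⟩⟩ := hb
    have hM : H0 ⊓ A = M.1 := congrArg Subtype.val hH0M
    rw [Nat.le_div_iff_mul_le hApos]
    refine le_trans (Nat.mul_le_mul_right _ ?_)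
      (aux_fiber_M A r hcomm (hr A le_rfl) M.1 H0 hM)
    refine Nat.card_le_card_of_injective
      (fun H => ⟨H.1.1, H.1.2.trans hH0.symm, congrArg Subtype.val H.2⟩) ?_
    intro H H' h
    exact Subtype.ext (Subtype.ext (Subtype.mk.inj h))
  calc _ ≤ _ := h1
    _ ≤ Nat.card A ^ r * (T / Nat.card A ^ r) := Nat.mul_le_mul_right _ (aux_count_sub A r hr)
    _ ≤ T := Nat.mul_div_le _ _

def auxDS {U : Type*} [Group U] (K : Subgroup U) : ℕ → Subgroup U
  | 0 => K
  | n + 1 => ⁅auxDS K n, auxDS K n⁆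

theorem auxDS_normal {U : Type*} [Group U] (K : Subgroup U) (hK : K.Normal) (n : ℕ) :
    (auxDS K n).Normal := by
  induction n with
  | zero => exact hK
  | succ n ih => exact Subgroup.commutator_normal _ _

theorem auxDS_le {U : Type*} [Group U] (K : Subgroup U) (hK : K.Normal) (n : ℕ) :
    auxDS K n ≤ K := by
  induction n with
  | zero => exact le_rfl
  | succ n ih =>
    have := auxDS_normal K hK n
    exact Subgroup.commutator_le_left _ _ |>.trans ih

theorem auxDS_map {U V : Type*} [Group U] [Group V] (f : U →* V) (K : Subgroup U) (n : ℕ) :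
    (auxDS K n).map f = auxDS (K.map f) n := by
  induction n with
  | zero => rfl
  | succ n ih => simp only [auxDS]; rw [Subgroup.map_commutator, ih]

theorem auxDS_derived {U : Type*} [Group U] (K : Subgroup U) (n : ℕ) :
    (derivedSeries K n).map K.subtype = auxDS K n := by
  induction n with
  | zero => simp [auxDS, ← MonoidHom.range_eq_map]
  | succ n ih => simp only [auxDS, derivedSeries_succ]; rw [Subgroup.map_commutator, ih]

theorem aux_main (r ℓ : ℕ) : ∀ (U : Type u) [Group U] [Finite U] (K : Subgroup U),
    K.Normal → auxDS K ℓ = ⊥ →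
    (∀ H : Subgroup U, H ≤ K → ∃ S : Finset U, S.card ≤ r ∧
      Subgroup.closure (S : Set U) = H) →
    Nat.card {H : Subgroup U // H ⊔ K = ⊤} ≤
      Nat.card K ^ (3 * r ^ 2) * Nat.card U ^ (ℓ * r) := by
  classical
  induction ℓ with
  | zero =>
    intro U _ _ K _ hK _
    have hK' : K = ⊥ := hK
    subst hK'
    have : Subsingleton {H : Subgroup U // H ⊔ (⊥ : Subgroup U) = ⊤} := ⟨fun a b => by
      apply Subtype.ext
      have h1 := a.2
      have h2 := b.2
      rw [sup_bot_eq] at h1 h2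
      rw [h1, h2]⟩
    simpa using Finite.card_le_one_iff_subsingleton.2 this
  | succ ℓ ih =>
    intro U _ _ K hKn hK hr
    set A := auxDS K ℓ with hA
    have hAn : A.Normal := auxDS_normal K hKn ℓ
    have hAK : A ≤ K := auxDS_le K hKn ℓ
    have hcomm : ∀ a ∈ A, ∀ b ∈ A, a * b = b * a := by
      intro a ha b hb
      have h1 : a * b * a⁻¹ * b⁻¹ ∈ ⁅A, A⁆ := Subgroup.commutator_mem_commutator ha hb
      have h2 : ⁅A, A⁆ = ⊥ := hK
      rw [h2, Subgroup.mem_bot] at h1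
      rwa [mul_inv_eq_one, mul_inv_eq_iff_eq_mul] at h1
    let q := QuotientGroup.mk' A
    have hq : Function.Surjective q := QuotientGroup.mk'_surjective A
    have hker : q.ker = A := QuotientGroup.ker_mk' A
    have hIH := ih (U ⧸ A) (K.map q) (hKn.map q hq) (by
        rw [← auxDS_map, ← hA, Subgroup.map_eq_bot_iff, hker]) (by
      intro H hH
      obtain ⟨S, hS, hc⟩ := hr (H.comap q ⊓ K) inf_le_right
      refine ⟨S.image q, Finset.card_image_le.trans hS, ?_⟩
      rw [Finset.coe_image, ← MonoidHom.map_closure, hc]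
      apply le_antisymm
      · rw [Subgroup.map_le_iff_le_comap]; exact inf_le_left
      · intro x hx
        obtain ⟨k, hk, rfl⟩ := hH hx
        exact ⟨k, ⟨hx, hk⟩, rfl⟩)
    have hfib : Nat.card {H : Subgroup U // H ⊔ K = ⊤} ≤
        Nat.card {H : Subgroup (U ⧸ A) // H ⊔ K.map q = ⊤} *
          (Nat.card A ^ (3 * r ^ 2) * Nat.card U ^ r) := by
      refine aux_fiber (fun H => (⟨H.1.map q, by
        rw [← Subgroup.map_sup, H.2, ← MonoidHom.range_eq_map, MonoidHom.range_eq_top.2 hq]⟩ :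
          {H : Subgroup (U ⧸ A) // H ⊔ K.map q = ⊤})) _ ?_
      intro Y
      refine le_trans ?_ (aux_fiber_X A r hcomm (fun H hH => hr H (hH.trans hAK)) (Y.1.comap q))
      refine Nat.card_le_card_of_injective (fun H => ⟨H.1.1, ?_⟩) ?_
      · rw [← congrArg Subtype.val H.2, Subgroup.comap_map_eq, hker]
      · intro H H' h
        exact Subtype.ext (Subtype.ext (Subtype.mk.inj h))
    have hcK : Nat.card (K.map q) * Nat.card A = Nat.card K := by
      have h1 := Subgroup.card_mul_index (A.subgroupOf K)
      have h2 : Nat.card (A.subgroupOf K) = Nat.card A :=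
        Nat.card_congr (Subgroup.subgroupOfEquivOfLe hAK).toEquiv
      have h3 : (A.subgroupOf K).index = Nat.card (K.map q) := by
        have h4 : (q.comp K.subtype).ker = A.subgroupOf K := by
          ext x
          simp [q, Subgroup.mem_subgroupOf]
        rw [← h4, Subgroup.index_ker, MonoidHom.range_comp, Subgroup.range_subtype]
      rw [← h1, h2, h3, mul_comm]
    have hcU : Nat.card (U ⧸ A) ≤ Nat.card U :=
      Nat.card_le_card_of_surjective q hq
    calc _ ≤ _ := hfib
      _ ≤ (Nat.card (K.map q) ^ (3 * r ^ 2) * Nat.card U ^ (ℓ * r)) *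
          (Nat.card A ^ (3 * r ^ 2) * Nat.card U ^ r) :=
        Nat.mul_le_mul_right _ (hIH.trans
          (Nat.mul_le_mul_left _ (Nat.pow_le_pow_left hcU _)))
      _ = (Nat.card (K.map q) * Nat.card A) ^ (3 * r ^ 2) *
          (Nat.card U ^ (ℓ * r) * Nat.card U ^ r) := by rw [mul_pow]; ring
      _ = _ := by rw [hcK, ← pow_add]; ring

theorem count_supplements_le (U L : Type*) [Group U] [Group L] [Finite U] [Finite L]
    (π : U →* L) (hπ : Function.Surjective π) (r ℓ : ℕ)
    (hsolv : derivedSeries (↥π.ker) ℓ = ⊥)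
    (hrank : ∀ H : Subgroup ↥π.ker, ∃ S : Finset ↥π.ker,
      S.card ≤ r ∧ Subgroup.closure (S : Set ↥π.ker) = H) :
    Nat.card {H : Subgroup U // H.map π = ⊤} ≤ Nat.card U ^ (3 * r ^ 2 + ℓ * r) := by
  classical
  have hm := aux_main r ℓ U π.ker inferInstance
    (by rw [← auxDS_derived, hsolv, Subgroup.map_bot]) (by
      intro H hH
      obtain ⟨S, hS, hc⟩ := hrank (H.subgroupOf π.ker)
      refine ⟨S.image π.ker.subtype, Finset.card_image_le.trans hS, ?_⟩
      rw [Finset.coe_image, ← MonoidHom.map_closure, hc, Subgroup.subgroupOf_map_subtype,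
        inf_eq_left.2 hH])
  have h1 : Nat.card {H : Subgroup U // H.map π = ⊤} ≤
      Nat.card {H : Subgroup U // H ⊔ π.ker = ⊤} := by
    refine Nat.card_le_card_of_injective (fun H => ⟨H.1, ?_⟩) ?_
    · rw [← Subgroup.comap_map_eq, H.2, Subgroup.comap_top]
    · intro H H' h
      exact Subtype.ext (Subtype.mk.inj h)
  refine h1.trans (hm.trans ?_)
  rw [pow_add]
  exact Nat.mul_le_mul_right _ (Nat.pow_le_pow_left (Subgroup.card_le_card_group _) _)
end
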